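/- arXiv:1211.0986 — 2 statements merged into one kernel-verified Lean document; each statement's English description precedes it below -/
import Mathlib

section
/- Let A be an mB × d complex matrix whose rows a_i all satisfy ‖a_i‖_∞ ≤ 1, and suppose that for every s' ≤ 2k, max_{b∈[m]} sup_{y∈T_{s'}} ‖A_b y‖₂ ≤ Q₁√B + Q₂√{s'}. Let x ∈ ℝ^d be supported on at most k coordinates with ‖x‖₁ ≤ 1, let Z_1,…,Z_s be i.i.d. random vectors with Z_i = sign(x_j)·e_j with probability |x_j| and Z_i = 0 with probability 1 − ‖x‖₁, let g be an independent standard Gaussian vector in ℝ^s, and set 𝒢(x) = E_{Z,g} ‖Σ_{i=1}^s g_i Z_i‖_X. Then 𝒢(x) ≤ C [ √(Bs) + √(log m) · (Q₁√B + Q₂√(min(k,s))) · √( s‖x‖_∞ + log k ) ] for an absolute constant C. -/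
open MeasureTheory Finset

noncomputable section

/-- Euclidean norm of a complex vector. -/
def l2norm {n : ℕ} (x : Fin n → ℂ) : ℝ := Real.sqrt (∑ i, ‖x i‖ ^ 2)

/-- Matrix-vector multiplication. -/
def mvec {n d : ℕ} (A : Fin n → Fin d → ℂ) (x : Fin d → ℂ) : Fin n → ℂ :=
  fun r => ∑ j, A r j * x j

/-- `Tset d k` : set of `k`-sparse complex vectors of Euclidean norm at most 1. -/
def Tset (d k : ℕ) : Set (Fin d → ℂ) :=
  {x | (Finset.univ.filter fun i => x i ≠ 0).card ≤ k ∧ l2norm x ≤ 1}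

/-- The bijection h(b,i) = B(b-1)+i (0-indexed: b*B+i). -/
def hIdx (m B : ℕ) (b : Fin m) (i : Fin B) : Fin (m * B) :=
  ⟨b.1 * B + i.1, by
    have hb := b.isLt
    have hi := i.isLt
    calc b.1 * B + i.1 < b.1 * B + B := by omega
      _ = (b.1 + 1) * B := by ring
      _ ≤ m * B := Nat.mul_le_mul hb le_rfl⟩

/-- The bucket matrix A_b, with rows a_{h(b,i)}, i ∈ [B]. -/
def bucket (m B d : ℕ) (A : Fin (m * B) → Fin d → ℂ) (b : Fin m) :
    Fin B → Fin d → ℂ :=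
  fun i j => A (hIdx m B b i) j

/-- ‖x‖_X = max_b ‖A_b x‖₂. -/
def Xnorm (m B d : ℕ) (A : Fin (m * B) → Fin d → ℂ) (x : Fin d → ℂ) : ℝ :=
  ⨆ b : Fin m, l2norm (mvec (bucket m B d A b) x)

/-- The vector `sign(x_j)·e_j ∈ ℝ^d`. -/
def sgnBasis (d : ℕ) (x : Fin d → ℝ) (j : Fin d) : Fin d → ℝ :=
  fun j' => if j' = j then Real.sign (x j) else 0

/-- The distribution of a single `Z_i`: equals `sign(x_j)·e_j` with probability `|x_j|` and
`0` with probability `1 − ‖x‖₁`. -/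
def Zdist (d : ℕ) (x : Fin d → ℝ) : Measure (Fin d → ℝ) :=
  ENNReal.ofReal (1 - ∑ j, |x j|) • Measure.dirac (0 : Fin d → ℝ)
    + ∑ j : Fin d, ENNReal.ofReal |x j| • Measure.dirac (sgnBasis d x j)

theorem inv_sqrt_one_sub_le_exp {u : ℝ} (h0 : 0 ≤ u) (h1 : u ≤ 1 / 2) :
    √((1 - u)⁻¹) ≤ Real.exp u := by
  rw [Real.sqrt_le_left (Real.exp_pos u).le, ← Real.exp_nat_mul]
  have h2 : 1 + 2 * u ≤ Real.exp ((2 : ℕ) * u) := by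
    have := Real.add_one_le_exp ((2 : ℕ) * u)
    push_cast at *; linarith
  refine le_trans ?_ h2
  rw [inv_le_iff_one_le_mul₀ (by linarith)]
  nlinarith

theorem gaussianReal_exp_mul_sq {a : ℝ} (h0 : 0 ≤ a) (h1 : a ≤ 1 / 4) :
    Integrable (fun x : ℝ ↦ Real.exp (a * x ^ 2)) (ProbabilityTheory.gaussianReal 0 1) ∧
      ∫ x, Real.exp (a * x ^ 2) ∂(ProbabilityTheory.gaussianReal 0 1) ≤ Real.exp (2 * a) := by
  have hb : 0 < 1 / 2 - a := by linarith
  have key : ∀ x : ℝ, ProbabilityTheory.gaussianPDFReal 0 1 x • Real.exp (a * x ^ 2)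
      = (√(2 * Real.pi))⁻¹ * Real.exp (-(1 / 2 - a) * x ^ 2) := by
    intro x
    simp only [ProbabilityTheory.gaussianPDFReal, smul_eq_mul, NNReal.coe_one, mul_one, sub_zero]
    rw [mul_assoc, ← Real.exp_add]
    congr 2
    ring
  constructor
  · rw [ProbabilityTheory.gaussianReal_of_var_ne_zero _ one_ne_zero,
      integrable_withDensity_iff_integrable_smul'
        (ProbabilityTheory.measurable_gaussianPDF 0 1) (ae_of_all _ fun _ ↦ ENNReal.ofReal_lt_top)]
    simp only [ProbabilityTheory.toReal_gaussianPDF, key]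
    exact (integrable_exp_neg_mul_sq hb).const_mul _
  · rw [ProbabilityTheory.integral_gaussianReal_eq_integral_smul one_ne_zero]
    simp only [key]
    rw [integral_const_mul, integral_gaussian, ← Real.sqrt_inv, ← Real.sqrt_mul (by positivity)]
    refine le_trans (le_of_eq ?_) (inv_sqrt_one_sub_le_exp (u := 2 * a) (by linarith) (by linarith))
    congr 1
    have := Real.pi_pos
    have : 1 - 2 * a ≠ 0 := by linarith
    field_simp

theorem exists_orthonormalBasis_norm_sq_eq {E F : Type*} [NormedAddCommGroup E]
    [InnerProductSpace ℝ E] [FiniteDimensional ℝ E] [NormedAddCommGroup F]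
    [InnerProductSpace ℝ F] [FiniteDimensional ℝ F] (T : E →ₗ[ℝ] F) :
    ∃ b : OrthonormalBasis (Fin (Module.finrank ℝ E)) ℝ E,
      ∀ x : Fin (Module.finrank ℝ E) → ℝ,
        ‖T (∑ i, x i • b i)‖ ^ 2 = ∑ i, ‖T (b i)‖ ^ 2 * x i ^ 2 := by
  have hs : (LinearMap.adjoint T ∘ₗ T).IsSymmetric := fun u v ↦ by
    simp only [LinearMap.comp_apply, LinearMap.adjoint_inner_left, LinearMap.adjoint_inner_right]
  refine ⟨hs.eigenvectorBasis rfl, fun x ↦ ?_⟩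
  set b := hs.eigenvectorBasis rfl
  have ho : ∀ i j, inner ℝ (T (b i)) (T (b j)) = if i = j then ‖T (b i)‖ ^ 2 else 0 := by
    intro i j
    split_ifs with h
    · subst h; exact real_inner_self_eq_norm_sq _
    · rw [← LinearMap.adjoint_inner_right]
      change inner ℝ (b i) ((LinearMap.adjoint T ∘ₗ T) (b j)) = 0
      rw [hs.apply_eigenvectorBasis rfl j, inner_smul_right, b.inner_eq_zero h, mul_zero]
  rw [← real_inner_self_eq_norm_sq, map_sum]
  simp only [map_smul, sum_inner, inner_sum, inner_smul_left, inner_smul_right, ho]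
  simp
  exact Finset.sum_congr rfl fun i _ ↦ by ring

theorem OrthonormalBasis.sum_norm_sq_map_eq {E F ι κ : Type*} [Fintype ι] [Fintype κ]
    [NormedAddCommGroup E] [InnerProductSpace ℝ E] [FiniteDimensional ℝ E]
    [NormedAddCommGroup F] [InnerProductSpace ℝ F] [FiniteDimensional ℝ F] (T : E →ₗ[ℝ] F)
    (b : OrthonormalBasis ι ℝ E) (e : OrthonormalBasis κ ℝ E) :
    ∑ i, ‖T (b i)‖ ^ 2 = ∑ j, ‖T (e j)‖ ^ 2 := by
  have h : ∀ v, ‖T v‖ ^ 2 = inner ℝ v ((LinearMap.adjoint T ∘ₗ T) v) := fun v ↦ by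
    rw [LinearMap.comp_apply, LinearMap.adjoint_inner_right, real_inner_self_eq_norm_sq]
  simp only [h, ← LinearMap.trace_eq_sum_inner]

theorem stdGaussian_exp_norm_sq {E F κ : Type*} [Fintype κ] [NormedAddCommGroup E]
    [InnerProductSpace ℝ E] [FiniteDimensional ℝ E] [MeasurableSpace E] [BorelSpace E]
    [NormedAddCommGroup F]
    [InnerProductSpace ℝ F] [FiniteDimensional ℝ F] (T : E →ₗ[ℝ] F)
    (e : OrthonormalBasis κ ℝ E) {t τ K : ℝ} (ht : 0 ≤ t) (htτ : t * τ ≤ 1 / 4)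
    (hτ : ∀ v, ‖T v‖ ^ 2 ≤ τ * ‖v‖ ^ 2) (hK : ∑ j, ‖T (e j)‖ ^ 2 ≤ K) :
    Integrable (fun x ↦ Real.exp (t * ‖T x‖ ^ 2)) (ProbabilityTheory.stdGaussian E) ∧
      ∫ x, Real.exp (t * ‖T x‖ ^ 2) ∂(ProbabilityTheory.stdGaussian E)
        ≤ Real.exp (2 * t * K) := by
  obtain ⟨b, hb⟩ := exists_orthonormalBasis_norm_sq_eq T
  have hT : Continuous T := T.continuous_of_finiteDimensional
  have hmeas : Continuous fun x ↦ Real.exp (t * ‖T x‖ ^ 2) := by fun_prop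
  have hprod : ∀ x : Fin (Module.finrank ℝ E) → ℝ,
      Real.exp (t * ‖T (∑ i, x i • b i)‖ ^ 2) =
        ∏ i, Real.exp (t * ‖T (b i)‖ ^ 2 * x i ^ 2) := by
    intro x
    rw [hb, mul_sum, Real.exp_sum]
    simp only [mul_assoc]
  have hone : ∀ i, t * ‖T (b i)‖ ^ 2 ≤ 1 / 4 := fun i ↦ by
    have := hτ (b i)
    rw [b.norm_eq_one] at this
    nlinarith
  have hmap : AEMeasurable (fun x : Fin (Module.finrank ℝ E) → ℝ ↦ ∑ i, x i • b i)
      (Measure.pi fun _ ↦ ProbabilityTheory.gaussianReal 0 1) :=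
    Measurable.aemeasurable (by fun_prop)
  rw [ProbabilityTheory.stdGaussian_eq_map_pi_orthonormalBasis b]
  constructor
  · rw [integrable_map_measure hmeas.aestronglyMeasurable hmap]
    simp only [Function.comp_def, hprod]
    exact Integrable.fintype_prod
      (f := fun i (x : ℝ) ↦ Real.exp (t * ‖T (b i)‖ ^ 2 * x ^ 2))
      fun i ↦ (gaussianReal_exp_mul_sq (by positivity) (hone i)).1
  · rw [integral_map hmap hmeas.aestronglyMeasurable]
    simp only [hprod]
    rw [integral_fintype_prod_eq_prod
      (f := fun i (x : ℝ) ↦ Real.exp (t * ‖T (b i)‖ ^ 2 * x ^ 2))]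
    calc _ ≤ ∏ i, Real.exp (2 * (t * ‖T (b i)‖ ^ 2)) :=
          Finset.prod_le_prod (fun i _ ↦ integral_nonneg fun x ↦ (Real.exp_pos _).le)
            fun i _ ↦ (gaussianReal_exp_mul_sq (by positivity) (hone i)).2
      _ = Real.exp (2 * t * ∑ i, ‖T (b i)‖ ^ 2) := by
          rw [← Real.exp_sum, mul_sum]
          simp only [mul_assoc]
      _ ≤ _ := by
          rw [b.sum_norm_sq_map_eq T e]
          gcongr

/-- Jensen's inequality for the square root, in a form that needs no integrability of `X`. -/
theorem integral_le_sqrt_of_sq_le {Ω : Type*} [MeasurableSpace Ω] {μ : Measure Ω}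
    [IsProbabilityMeasure μ] {X W : Ω → ℝ} {K : ℝ} (hX : ∀ᵐ ω ∂μ, 0 ≤ X ω)
    (hXW : ∀ᵐ ω ∂μ, X ω ^ 2 ≤ W ω) (hW : Integrable W μ) (hK : ∫ ω, W ω ∂μ ≤ K) :
    ∫ ω, X ω ∂μ ≤ √K := by
  have h0 : 0 ≤ ∫ ω, W ω ∂μ :=
    integral_nonneg_of_ae (hXW.mono fun ω h ↦ (sq_nonneg _).trans h)
  refine le_of_forall_pos_le_add fun ε hε ↦ ?_
  set a := √K + ε
  have ha : 0 < a := by positivity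
  have hKa : K ≤ a ^ 2 := by
    have := Real.sq_sqrt (h0.trans hK)
    have := Real.sqrt_nonneg K
    simp only [a]; nlinarith
  calc ∫ ω, X ω ∂μ ≤ ∫ ω, (1 / (2 * a) * W ω + a / 2) ∂μ := by
        refine integral_mono_of_nonneg hX ((hW.const_mul _).add (integrable_const _)) ?_
        filter_upwards [hXW] with ω h
        have : 1 / (2 * a) * W ω + a / 2 = (W ω + a ^ 2) / (2 * a) := by field_simp
        rw [this, le_div_iff₀ (by positivity)]
        nlinarith [sq_nonneg (X ω - a)]
    _ = 1 / (2 * a) * ∫ ω, W ω ∂μ + a / 2 := by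
        rw [integral_add (hW.const_mul _) (integrable_const _), integral_const_mul]
        simp
    _ ≤ 1 / (2 * a) * a ^ 2 + a / 2 := by gcongr; exact hK.trans hKa
    _ = a := by field_simp; norm_num

theorem le_log_add_div_sub_one {u y c : ℝ} (hc : 0 < c) (h : Real.exp u ≤ y) :
    u ≤ Real.log c + y / c - 1 := by
  have hy : 0 < y := (Real.exp_pos u).trans_le h
  have h1 : u ≤ Real.log y := (Real.le_log_iff_exp_le hy).2 h
  have h2 := Real.log_le_sub_one_of_pos (div_pos hy hc)
  rw [Real.log_div hy.ne' hc.ne'] at h2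
  linarith

theorem integral_iSup_norm_stdGaussian_le {E F κ ι : Type*} [Fintype κ] [Fintype ι]
    [NormedAddCommGroup E]
    [InnerProductSpace ℝ E] [FiniteDimensional ℝ E] [MeasurableSpace E] [BorelSpace E]
    [NormedAddCommGroup F]
    [InnerProductSpace ℝ F] [FiniteDimensional ℝ F] (T : ι → E →ₗ[ℝ] F)
    (e : OrthonormalBasis κ ℝ E) {τ K : ℝ} (h0 : 0 ≤ τ)
    (hτ : ∀ i v, ‖T i v‖ ^ 2 ≤ τ * ‖v‖ ^ 2) (hK : ∀ i, ∑ j, ‖T i (e j)‖ ^ 2 ≤ K) :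
    ∫ x, (⨆ i, ‖T i x‖) ∂(ProbabilityTheory.stdGaussian E)
      ≤ √(2 * K + 4 * τ * Real.log (Fintype.card ι)) := by
  rcases isEmpty_or_nonempty ι with hι | hι
  · simp
  have hcard : 0 < (Fintype.card ι : ℝ) := by exact_mod_cast Fintype.card_pos
  have hlog : 0 ≤ Real.log (Fintype.card ι) := Real.log_natCast_nonneg _
  have main : ∀ σ : ℝ, τ < σ → ∫ x, (⨆ i, ‖T i x‖) ∂(ProbabilityTheory.stdGaussian E)
      ≤ √(2 * K + 4 * σ * Real.log (Fintype.card ι)) := by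
    intro σ hσ
    have hσ0 : 0 < σ := h0.trans_lt hσ
    set t := 1 / (4 * σ) with ht
    have ht0 : 0 < t := by positivity
    have hI := fun i ↦ stdGaussian_exp_norm_sq (T i) e ht0.le (τ := σ)
      (by rw [ht]; field_simp; norm_num)
      (fun v ↦ (hτ i v).trans (by gcongr)) (hK i)
    set c := Fintype.card ι * Real.exp (2 * t * K)
    have hc : 0 < c := by positivity
    set Y : E → ℝ := fun x ↦ ∑ i, Real.exp (t * ‖T i x‖ ^ 2)
    have hY : Integrable Y (ProbabilityTheory.stdGaussian E) :=
      integrable_finsetSum _ fun i _ ↦ (hI i).1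
    have hYc : ∫ x, Y x ∂(ProbabilityTheory.stdGaussian E) ≤ c := by
      rw [integral_finsetSum _ fun i _ ↦ (hI i).1]
      refine (sum_le_sum fun i _ ↦ (hI i).2).trans ?_
      simp [c]
    have hWi : Integrable (fun x ↦ t⁻¹ * (Real.log c - 1 + c⁻¹ * Y x))
        (ProbabilityTheory.stdGaussian E) :=
      ((integrable_const _).add (hY.const_mul _)).const_mul _
    refine integral_le_sqrt_of_sq_le (W := fun x ↦ t⁻¹ * (Real.log c - 1 + c⁻¹ * Y x))
      (ae_of_all _ fun x ↦ Real.iSup_nonneg fun i ↦ norm_nonneg _)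
      (ae_of_all _ fun x ↦ ?_) hWi ?_
    · obtain ⟨i, hi⟩ := exists_eq_ciSup_of_finite (f := fun i ↦ ‖T i x‖)
      rw [← hi, inv_mul_eq_div, le_div_iff₀ ht0, mul_comm]
      have := le_log_add_div_sub_one hc (u := t * ‖T i x‖ ^ 2) (y := Y x)
        (single_le_sum (f := fun i ↦ Real.exp (t * ‖T i x‖ ^ 2))
          (fun i _ ↦ (Real.exp_pos _).le) (mem_univ i))
      rw [div_eq_inv_mul] at this
      linarith
    · rw [integral_const_mul, integral_add (integrable_const _) (hY.const_mul _),
        integral_const_mul, integral_const]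
      simp only [probReal_univ, smul_eq_mul, one_mul]
      calc _ ≤ t⁻¹ * (Real.log c - 1 + c⁻¹ * c) := by gcongr
        _ = t⁻¹ * (Real.log (Fintype.card ι) + 2 * t * K) := by
            rw [inv_mul_cancel₀ hc.ne', Real.log_mul hcard.ne' (Real.exp_pos _).ne', Real.log_exp]
            ring
        _ = _ := by rw [ht]; field_simp; ring
  have hcont : Filter.Tendsto (fun σ : ℝ ↦ √(2 * K + 4 * σ * Real.log (Fintype.card ι)))
      (nhdsWithin τ (Set.Ioi τ)) (nhds (√(2 * K + 4 * τ * Real.log (Fintype.card ι)))) :=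
    (Continuous.tendsto (by fun_prop) τ).mono_left nhdsWithin_le_nhds
  exact ge_of_tendsto hcont (eventually_nhdsWithin_of_forall fun σ hσ ↦ main σ hσ)

theorem l2norm_eq_norm_toLp {n : ℕ} (y : Fin n → ℂ) :
    l2norm y = ‖(WithLp.toLp 2 y : PiLp 2 fun _ : Fin n ↦ ℂ)‖ := by
  rw [l2norm, PiLp.norm_eq_of_L2]

theorem l2norm_sq {n : ℕ} (y : Fin n → ℂ) : l2norm y ^ 2 = ∑ i, ‖y i‖ ^ 2 :=
  Real.sq_sqrt (by positivity)

theorem l2norm_smul {n : ℕ} (c : ℂ) (y : Fin n → ℂ) : l2norm (c • y) = ‖c‖ * l2norm y := by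
  rw [l2norm_eq_norm_toLp, l2norm_eq_norm_toLp, WithLp.toLp_smul, norm_smul]

theorem mvec_smul {n d : ℕ} (A : Fin n → Fin d → ℂ) (c : ℂ) (y : Fin d → ℂ) :
    mvec A (c • y) = c • mvec A y := by
  ext r
  simp only [mvec, Pi.smul_apply, smul_eq_mul, mul_sum]
  exact sum_congr rfl fun j _ ↦ by ring

theorem l2norm_mvec_le_of_sparse {n d s' : ℕ} {A : Fin n → Fin d → ℂ} {L : ℝ}
    (hA : ∀ y ∈ Tset d s', l2norm (mvec A y) ≤ L) {y : Fin d → ℂ}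
    (hy : (univ.filter fun i ↦ y i ≠ 0).card ≤ s') :
    l2norm (mvec A y) ≤ L * l2norm y := by
  rcases eq_or_ne (l2norm y) 0 with h | h
  · have : y = 0 := by
      rw [l2norm_eq_norm_toLp, norm_eq_zero] at h
      simpa using h
    subst this
    simp [mvec, l2norm]
  · have hpos : 0 < l2norm y := lt_of_le_of_ne (Real.sqrt_nonneg _) h.symm
    have hc : ‖((l2norm y)⁻¹ : ℂ)‖ = (l2norm y)⁻¹ := by
      rw [norm_inv, Complex.norm_real, Real.norm_of_nonneg hpos.le]
    have hmem : ((l2norm y)⁻¹ : ℂ) • y ∈ Tset d s' := by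
      refine ⟨(card_le_card fun i ↦ ?_).trans hy, ?_⟩
      · simp only [mem_filter, mem_univ, true_and, Pi.smul_apply, smul_eq_mul]
        exact right_ne_zero_of_mul
      · rw [l2norm_smul, hc, inv_mul_cancel₀ h]
    have := hA _ hmem
    rw [mvec_smul, l2norm_smul, hc, inv_mul_le_iff₀ hpos] at this
    linarith

theorem zero_mem_Tset (d s' : ℕ) : (0 : Fin d → ℂ) ∈ Tset d s' := by
  simp [Tset, l2norm]

/-- `∑ᵢ gᵢ Zᵢ` as a complex vector. -/
def realCombo {s d : ℕ} (Z : Fin s → Fin d → ℝ) (g : Fin s → ℝ) : Fin d → ℂ :=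
  fun j ↦ ((∑ i, g i * Z i j : ℝ) : ℂ)

/-- The linear map `g ↦ A (∑ᵢ gᵢ Zᵢ)` between Euclidean spaces. -/
def comboMap {n d s : ℕ} (A : Fin n → Fin d → ℂ) (Z : Fin s → Fin d → ℝ) :
    EuclideanSpace ℝ (Fin s) →ₗ[ℝ] PiLp 2 fun _ : Fin n ↦ ℂ where
  toFun g := WithLp.toLp 2 (mvec A (realCombo Z g))
  map_add' g g' := by
    ext r
    simp [mvec, realCombo, add_mul, sum_add_distrib, mul_add]
  map_smul' c g := by
    ext r
    simp only [mvec, realCombo, PiLp.smul_apply, smul_eq_mul, RingHom.id_apply,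
      Complex.real_smul, mul_sum, mul_assoc, Complex.ofReal_sum, Complex.ofReal_mul]
    exact sum_congr rfl fun j _ ↦ sum_congr rfl fun i _ ↦ by ring

theorem norm_comboMap {n d s : ℕ} (A : Fin n → Fin d → ℂ) (Z : Fin s → Fin d → ℝ)
    (g : EuclideanSpace ℝ (Fin s)) : ‖comboMap A Z g‖ = l2norm (mvec A (realCombo Z g)) :=
  (l2norm_eq_norm_toLp _).symm

/-- The values taken by the sampling distribution `Zdist`. -/
def IsSample {d : ℕ} (x z : Fin d → ℝ) : Prop :=
  z = 0 ∨ ∃ j, x j ≠ 0 ∧ z = sgnBasis d x j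

theorem sign_sq_of_ne_zero {t : ℝ} (h : t ≠ 0) : Real.sign t ^ 2 = 1 := by
  rcases Real.sign_apply_eq_of_ne_zero t h with h | h <;> simp [h]

theorem IsSample.sum_sq_le_one {d : ℕ} {x z : Fin d → ℝ} (h : IsSample x z) :
    ∑ j, z j ^ 2 ≤ 1 := by
  rcases h with rfl | ⟨j, hj, rfl⟩
  · simp
  · simp [sgnBasis, ite_pow, sign_sq_of_ne_zero hj]

theorem IsSample.eq_mul_sq {d : ℕ} {x z : Fin d → ℝ} (h : IsSample x z) (j : Fin d) :
    z j = z j * z j ^ 2 := by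
  rcases h with rfl | ⟨j', hj, rfl⟩
  · simp
  · by_cases hjj : j = j'
    · simp [sgnBasis, hjj, sign_sq_of_ne_zero hj]
    · simp [sgnBasis, hjj]

theorem IsSample.eq_zero_of_eq_zero {d : ℕ} {x z : Fin d → ℝ} (h : IsSample x z) {j : Fin d}
    (hj : x j = 0) : z j = 0 := by
  rcases h with rfl | ⟨j', hj', rfl⟩
  · simp
  · have : j ≠ j' := by rintro rfl; exact hj' hj
    simp [sgnBasis, this]

theorem IsSample.card_support_le_one {d : ℕ} {x z : Fin d → ℝ} (h : IsSample x z) :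
    (univ.filter fun j ↦ z j ≠ 0).card ≤ 1 := by
  rcases h with rfl | ⟨j', hj', rfl⟩
  · simp
  · refine (card_le_card (t := {j'}) fun j ↦ ?_).trans (by simp)
    contrapose!
    intro hne
    rw [mem_singleton] at hne
    simp [sgnBasis, hne]

theorem IsSample.l2norm_mvec_sq_le {n d : ℕ} {x z : Fin d → ℝ} (h : IsSample x z)
    {A : Fin n → Fin d → ℂ} (hA : ∀ r j, ‖A r j‖ ≤ 1) :
    l2norm (mvec A fun j ↦ (z j : ℂ)) ^ 2 ≤ n := by
  rw [l2norm_sq]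
  have : ∀ r, ‖mvec A (fun j ↦ (z j : ℂ)) r‖ ^ 2 ≤ 1 := by
    intro r
    rcases h with rfl | ⟨j, hj, rfl⟩
    · simp [mvec]
    · have h1 : mvec A (fun i ↦ (sgnBasis d x j i : ℂ)) r = A r j * (Real.sign (x j) : ℂ) := by
        simp only [mvec, sgnBasis]
        rw [sum_eq_single j] <;> simp +contextual
      rw [h1, norm_mul, mul_pow, Complex.norm_real, Real.norm_eq_abs, sq_abs,
        sign_sq_of_ne_zero hj, mul_one]
      exact pow_le_one₀ (norm_nonneg _) (hA r j)
  exact (sum_le_sum fun r _ ↦ this r).trans (by simp)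

theorem l2norm_realCombo_sq_le {d s : ℕ} {x : Fin d → ℝ} {Z : Fin s → Fin d → ℝ}
    (hZ : ∀ i, IsSample x (Z i)) {N : ℝ} (h0 : 0 ≤ N) (hN : ∀ j, ∑ i, Z i j ^ 2 ≤ N)
    (g : Fin s → ℝ) : l2norm (realCombo Z g) ^ 2 ≤ N * ∑ i, g i ^ 2 := by
  rw [l2norm_sq]
  calc ∑ j, ‖realCombo Z g j‖ ^ 2 = ∑ j, (∑ i, g i * Z i j) ^ 2 := by
        simp only [realCombo, Complex.norm_real, Real.norm_eq_abs, sq_abs]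
    _ = ∑ j, (∑ i, (g i * Z i j) * (Z i j ^ 2)) ^ 2 := by
        refine sum_congr rfl fun j _ ↦ ?_
        congr 1
        exact sum_congr rfl fun i _ ↦ by rw [mul_assoc, ← (hZ i).eq_mul_sq j]
    _ ≤ ∑ j, (∑ i, (g i * Z i j) ^ 2) * ∑ i, (Z i j ^ 2) ^ 2 :=
        sum_le_sum fun j _ ↦ sum_mul_sq_le_sq_mul_sq _ _ _
    _ ≤ ∑ j, (∑ i, (g i * Z i j) ^ 2) * N := by
        gcongr with j
        refine le_trans (le_of_eq (sum_congr rfl fun i _ ↦ ?_)) (hN j)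
        linear_combination -(Z i j) * (hZ i).eq_mul_sq j
    _ = N * ∑ i, g i ^ 2 * ∑ j, Z i j ^ 2 := by
        rw [← sum_mul, sum_comm, mul_comm]
        simp only [mul_pow, mul_sum]
    _ ≤ N * ∑ i, g i ^ 2 * 1 := by
        gcongr with i
        exact (hZ i).sum_sq_le_one
    _ = _ := by simp

theorem card_support_realCombo_le {d s k : ℕ} {x : Fin d → ℝ} {Z : Fin s → Fin d → ℝ}
    (hZ : ∀ i, IsSample x (Z i)) (hx : (univ.filter fun i ↦ x i ≠ 0).card ≤ k)
    (g : Fin s → ℝ) : (univ.filter fun j ↦ realCombo Z g j ≠ 0).card ≤ min k s := by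
  have key : ∀ j, realCombo Z g j ≠ 0 → ∃ i, Z i j ≠ 0 := by
    intro j hj
    by_contra! h
    exact hj (by simp [realCombo, h])
  refine le_min ((card_le_card fun j ↦ ?_).trans hx) ?_
  · simp only [mem_filter, mem_univ, true_and]
    intro hj h0
    obtain ⟨i, hi⟩ := key j hj
    exact hi ((hZ i).eq_zero_of_eq_zero h0)
  · calc _ ≤ (univ.biUnion fun i ↦ univ.filter fun j ↦ Z i j ≠ 0).card := by
          refine card_le_card fun j ↦ ?_
          simpa using key j
      _ ≤ ∑ i : Fin s, 1 :=
          card_biUnion_le.trans (sum_le_sum fun i _ ↦ (hZ i).card_support_le_one)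
      _ = s := by simp

theorem integral_Xnorm_realCombo_le {m B d k s : ℕ} {L : ℝ} {A : Fin (m * B) → Fin d → ℂ}
    {x : Fin d → ℝ} (hA : ∀ r j, ‖A r j‖ ≤ 1)
    (hL : ∀ b : Fin m, ∀ y ∈ Tset d (min k s), l2norm (mvec (bucket m B d A b) y) ≤ L)
    (hx : (univ.filter fun i ↦ x i ≠ 0).card ≤ k) {Z : Fin s → Fin d → ℝ}
    (hZ : ∀ i, IsSample x (Z i)) {N : ℝ} (h0 : 0 ≤ N) (hN : ∀ j, ∑ i, Z i j ^ 2 ≤ N) :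
    ∫ g, Xnorm m B d A (realCombo Z g)
        ∂(Measure.pi fun _ : Fin s ↦ ProbabilityTheory.gaussianReal 0 1)
      ≤ √(2 * (B * s) + 4 * (L ^ 2 * N) * Real.log m) := by
  have hint : ∫ g, Xnorm m B d A (realCombo Z g)
        ∂(Measure.pi fun _ : Fin s ↦ ProbabilityTheory.gaussianReal 0 1) =
      ∫ g, (⨆ b, ‖comboMap (bucket m B d A b) Z g‖)
        ∂(ProbabilityTheory.stdGaussian (EuclideanSpace ℝ (Fin s))) := by
    rw [← ProbabilityTheory.map_pi_eq_stdGaussian]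
    refine Eq.trans ?_ ((MeasurableEquiv.toLp 2 (Fin s → ℝ)).measurableEmbedding.integral_map
      fun g ↦ ⨆ b, ‖comboMap (bucket m B d A b) Z g‖).symm
    simp only [norm_comboMap]
    rfl
  rw [hint]
  refine (integral_iSup_norm_stdGaussian_le (fun b ↦ comboMap (bucket m B d A b) Z)
    (EuclideanSpace.basisFun (Fin s) ℝ) (τ := L ^ 2 * N) (K := B * s) (by positivity)
    (fun b v ↦ ?_) (fun b ↦ ?_)).trans (by simp)
  · have hL0 : 0 ≤ L := (Real.sqrt_nonneg _).trans (hL b 0 (zero_mem_Tset _ _))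
    rw [norm_comboMap, EuclideanSpace.real_norm_sq_eq, mul_assoc]
    calc _ ≤ (L * l2norm (realCombo Z v)) ^ 2 := by
          gcongr
          · exact Real.sqrt_nonneg _
          · exact l2norm_mvec_le_of_sparse (hL b) (card_support_realCombo_le hZ hx v)
      _ ≤ _ := by
          rw [mul_pow]
          gcongr
          exact l2norm_realCombo_sq_le hZ h0 hN v
  · have : ∀ i, ‖comboMap (bucket m B d A b) Z (EuclideanSpace.basisFun (Fin s) ℝ i)‖ ^ 2
        ≤ B := by
      intro i
      have h1 : realCombo Z (EuclideanSpace.basisFun (Fin s) ℝ i) = fun j ↦ (Z i j : ℂ) := by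
        ext j
        simp [realCombo]
      rw [norm_comboMap, h1]
      exact (hZ i).l2norm_mvec_sq_le fun r j ↦ hA _ j
    exact (sum_le_sum fun i _ ↦ this i).trans (by simp [mul_comm])

theorem integrable_Zdist {d : ℕ} (x : Fin d → ℝ) (f : (Fin d → ℝ) → ℝ) :
    Integrable f (Zdist d x) := by
  unfold Zdist
  refine Integrable.add_measure ?_ (integrable_finsetSum_measure.2 fun j _ ↦ ?_)
  all_goals exact (integrable_dirac (by simp)).smul_measure ENNReal.ofReal_ne_top

theorem integral_Zdist {d : ℕ} {x : Fin d → ℝ} (hx : ∑ j, |x j| ≤ 1) (f : (Fin d → ℝ) → ℝ) :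
    ∫ z, f z ∂(Zdist d x) = (1 - ∑ j, |x j|) * f 0 + ∑ j, |x j| * f (sgnBasis d x j) := by
  have h := integrable_Zdist x f
  unfold Zdist at h ⊢
  rw [integrable_add_measure] at h
  rw [integral_add_measure h.1 h.2,
    integral_finsetSum_measure fun i _ ↦ integrable_finsetSum_measure.1 h.2 i (mem_univ i)]
  simp [integral_smul_measure, ENNReal.toReal_ofReal, sub_nonneg.2 hx]

theorem ae_Zdist_isSample {d : ℕ} (x : Fin d → ℝ) : ∀ᵐ z ∂(Zdist d x), IsSample x z := by
  unfold Zdist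
  rw [ae_add_measure_iff]
  refine ⟨Measure.ae_smul_measure ?_ _, ?_⟩
  · rw [ae_dirac_eq]; exact Or.inl rfl
  · rw [ae_finsetSum_measure_iff]
    intro j _
    by_cases hj : x j = 0
    · simp [hj]
    · refine Measure.ae_smul_measure ?_ _
      rw [ae_dirac_eq]; exact Or.inr ⟨j, hj, rfl⟩

theorem integral_exp_sq_Zdist_le {d : ℕ} {x : Fin d → ℝ} (hx : ∑ j, |x j| ≤ 1) (j : Fin d) :
    ∫ z, Real.exp (z j ^ 2) ∂(Zdist d x) ≤ Real.exp (2 * |x j|) := by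
  rw [integral_Zdist hx]
  have h : ∀ i, |x i| * Real.exp (sgnBasis d x i j ^ 2) ≤
      |x i| + if j = i then 2 * |x j| else 0 := by
    intro i
    split_ifs with hij
    · subst hij
      have := abs_nonneg (x j)
      have he := Real.exp_one_lt_d9
      rcases eq_or_ne (x j) 0 with h0 | h0
      · simp [h0]
      · simp only [sgnBasis, if_true, sign_sq_of_ne_zero h0]
        nlinarith
    · simp [sgnBasis, hij]
  calc _ ≤ (1 - ∑ j, |x j|) * 1 + ∑ i, (|x i| + if j = i then 2 * |x j| else 0) := by
        refine add_le_add (le_of_eq (by simp)) (sum_le_sum fun i _ ↦ h i)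
    _ = 2 * |x j| + 1 := by rw [sum_add_distrib]; simp; ring
    _ ≤ _ := Real.add_one_le_exp _

theorem exists_multiplicity_bound {d k s : ℕ} {x : Fin d → ℝ}
    [IsProbabilityMeasure (Zdist d x)] (hx1 : ∑ j, |x j| ≤ 1)
    (hx : (univ.filter fun i ↦ x i ≠ 0).card ≤ k) :
    ∃ W : (Fin s → Fin d → ℝ) → ℝ, Integrable W (Measure.pi fun _ : Fin s ↦ Zdist d x) ∧
      (∀ Z : Fin s → Fin d → ℝ, (∀ i, IsSample x (Z i)) →
        0 ≤ W Z ∧ ∀ j, ∑ i, Z i j ^ 2 ≤ W Z) ∧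
      ∫ Z, W Z ∂(Measure.pi fun _ : Fin s ↦ Zdist d x)
        ≤ 2 * (s * (⨆ j, |x j|) + Real.log k) := by
  set S := univ.filter fun i ↦ x i ≠ 0 with hS
  set M := ⨆ j, |x j|
  have hM0 : 0 ≤ M := Real.iSup_nonneg fun j ↦ abs_nonneg _
  have hMj : ∀ j, |x j| ≤ M := fun j ↦ le_ciSup (f := fun j ↦ |x j|) (Set.finite_range _).bddAbove j
  have hk : 0 ≤ Real.log k := Real.log_natCast_nonneg k
  have hzero : ∀ Z : Fin s → Fin d → ℝ, (∀ i, IsSample x (Z i)) → ∀ j ∉ S,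
      ∑ i, Z i j ^ 2 = 0 := by
    intro Z hZ j hj
    have hj : x j = 0 := by simpa [hS] using hj
    exact sum_eq_zero fun i _ ↦ by rw [(hZ i).eq_zero_of_eq_zero hj]; simp
  rcases S.eq_empty_or_nonempty with hE | hne
  · exact ⟨fun _ ↦ 0, integrable_const _,
      fun Z hZ ↦ ⟨le_rfl, fun j ↦ (hzero Z hZ j (by simp [hE])).le⟩, by simp; positivity⟩
  have hcard : 0 < (S.card : ℝ) := by exact_mod_cast hne.card_pos
  set c := S.card * Real.exp (2 * (s * M))
  have hc : 0 < c := by positivity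
  have hexp : ∀ (Z : Fin s → Fin d → ℝ) j,
      Real.exp (∑ i, Z i j ^ 2) = ∏ i, Real.exp (Z i j ^ 2) := fun Z j ↦ Real.exp_sum _ _
  set Y : (Fin s → Fin d → ℝ) → ℝ := fun Z ↦ ∑ j ∈ S, Real.exp (∑ i, Z i j ^ 2)
  have hI : ∀ j, Integrable (fun Z : Fin s → Fin d → ℝ ↦ Real.exp (∑ i, Z i j ^ 2))
      (Measure.pi fun _ : Fin s ↦ Zdist d x) := fun j ↦ by
    simp only [hexp]
    exact Integrable.fintype_prod (f := fun _ (z : Fin d → ℝ) ↦ Real.exp (z j ^ 2))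
      fun _ ↦ integrable_Zdist x _
  have hY : Integrable Y (Measure.pi fun _ : Fin s ↦ Zdist d x) :=
    integrable_finsetSum _ fun j _ ↦ hI j
  have hYc : ∫ Z, Y Z ∂(Measure.pi fun _ : Fin s ↦ Zdist d x) ≤ c := by
    rw [integral_finsetSum _ fun j _ ↦ hI j]
    have : ∀ j, ∫ Z : Fin s → Fin d → ℝ, Real.exp (∑ i, Z i j ^ 2)
        ∂(Measure.pi fun _ : Fin s ↦ Zdist d x) ≤ Real.exp (2 * (s * M)) := by
      intro j
      simp only [hexp]
      rw [integral_fintype_prod_eq_prod (f := fun _ (z : Fin d → ℝ) ↦ Real.exp (z j ^ 2)),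
        prod_const, card_univ, Fintype.card_fin]
      calc _ ≤ Real.exp (2 * M) ^ s := by
            refine pow_le_pow_left₀ (integral_nonneg fun z ↦ ?_) ?_ s
            · exact (Real.exp_pos (z j ^ 2)).le
            · exact (integral_exp_sq_Zdist_le hx1 j).trans (by gcongr; exact hMj j)
        _ = _ := by rw [← Real.exp_nat_mul]; congr 1; ring
    refine (sum_le_sum fun j _ ↦ this j).trans ?_
    simp [c]
  refine ⟨fun Z ↦ Real.log c - 1 + c⁻¹ * Y Z, (integrable_const _).add (hY.const_mul _),
    fun Z hZ ↦ ?_, ?_⟩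
  · have key : ∀ j ∈ S, ∑ i, Z i j ^ 2 ≤ Real.log c - 1 + c⁻¹ * Y Z := by
      intro j hj
      have := le_log_add_div_sub_one hc (u := ∑ i, Z i j ^ 2) (y := Y Z)
        (single_le_sum (f := fun j ↦ Real.exp (∑ i, Z i j ^ 2))
          (fun i _ ↦ (Real.exp_pos _).le) hj)
      rw [div_eq_inv_mul] at this
      linarith
    have hW0 : 0 ≤ Real.log c - 1 + c⁻¹ * Y Z := by
      obtain ⟨j, hj⟩ := hne
      exact (sum_nonneg fun i _ ↦ sq_nonneg _).trans (key j hj)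
    refine ⟨hW0, fun j ↦ ?_⟩
    by_cases hj : j ∈ S
    · exact key j hj
    · rw [hzero Z hZ j hj]; exact hW0
  · rw [integral_add (integrable_const _) (hY.const_mul _), integral_const_mul, integral_const]
    simp only [probReal_univ, smul_eq_mul, one_mul]
    calc _ ≤ Real.log c - 1 + c⁻¹ * c := by gcongr
      _ = Real.log S.card + 2 * (s * M) := by
          rw [inv_mul_cancel₀ hc.ne', Real.log_mul hcard.ne' (Real.exp_pos _).ne', Real.log_exp]
          ring
      _ ≤ Real.log k + 2 * (s * M) := by gcongr
      _ ≤ _ := by linarith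

/-- second bound of Lemma `infl1bound`: for `k`-sparse `x` with `‖x‖₁ ≤ 1`,
under the bucket bound `ℓ(s') = Q₁√B + Q₂√s'` for `s' ≤ 2k`, the Gaussian mean width
`𝒢(x) = E_{Z,g}‖Σᵢ gᵢ Zᵢ‖_X` is at most
`C[√(Bs) + √(log m)·(Q₁√B + Q₂√(min(k,s)))·√(s‖x‖_∞ + log k)]`. -/
theorem stmt7 :
    ∃ C : ℝ, 0 < C ∧
      ∀ (m B d k s : ℕ) (Q₁ Q₂ : ℝ) (A : Fin (m * B) → Fin d → ℂ) (x : Fin d → ℝ)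
        (μZ : Measure (Fin d → ℝ)) [IsProbabilityMeasure μZ],
        (∀ r j, ‖A r j‖ ≤ 1) →
        (∀ s' ≤ 2 * k, ∀ b : Fin m, ∀ y ∈ Tset d s',
          l2norm (mvec (bucket m B d A b) y) ≤ Q₁ * Real.sqrt B + Q₂ * Real.sqrt s') →
        (Finset.univ.filter fun i => x i ≠ 0).card ≤ k →
        (∑ j, |x j|) ≤ 1 →
        μZ = Zdist d x →
        (∫ Z, (∫ g, Xnorm m B d A (fun j => ((∑ i, g i * Z i j : ℝ) : ℂ))
                ∂(Measure.pi fun _ : Fin s => ProbabilityTheory.gaussianReal 0 1))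
            ∂(Measure.pi fun _ : Fin s => μZ))
          ≤ C * (Real.sqrt ((B : ℝ) * s)
              + Real.sqrt (Real.log m) *
                  (Q₁ * Real.sqrt B + Q₂ * Real.sqrt (min (k : ℝ) (s : ℝ))) *
                  Real.sqrt ((s : ℝ) * (⨆ j : Fin d, |x j|) + Real.log k)) := by
  refine ⟨3, by norm_num, ?_⟩
  intro m B d k s Q₁ Q₂ A x μZ _ hA hQ hx hx1 hμ
  subst hμ
  set M := ⨆ j : Fin d, |x j|
  have hM0 : 0 ≤ M := Real.iSup_nonneg fun j ↦ abs_nonneg _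
  set L := Q₁ * √(B : ℝ) + Q₂ * √(min (k : ℝ) (s : ℝ))
  have hL : ∀ b : Fin m, ∀ y ∈ Tset d (min k s), l2norm (mvec (bucket m B d A b) y) ≤ L := by
    intro b y hy
    have := hQ (min k s) (by omega) b y hy
    rwa [Nat.cast_min] at this
  have hk : 0 ≤ Real.log k := Real.log_natCast_nonneg k
  have hm : 0 ≤ Real.log m := Real.log_natCast_nonneg m
  have hmL : 0 ≤ √(Real.log m) * L := by
    rcases Nat.eq_zero_or_pos m with rfl | hmpos
    · simp
    · exact mul_nonneg (Real.sqrt_nonneg _)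
        ((Real.sqrt_nonneg _).trans (hL ⟨0, hmpos⟩ 0 (zero_mem_Tset _ _)))
  obtain ⟨W, hWi, hW, hWK⟩ := exists_multiplicity_bound (s := s) hx1 hx
  have hsamp : ∀ᵐ Z ∂(Measure.pi fun _ : Fin s ↦ Zdist d x), ∀ i, IsSample x (Z i) :=
    ae_all_iff.2 fun i ↦ Measure.tendsto_eval_ae_ae.eventually (ae_Zdist_isSample x)
  set K := 2 * ((B : ℝ) * s) + 4 * L ^ 2 * Real.log m * (2 * (s * M + Real.log k)) with hK
  have hmain : ∫ Z, (∫ g, Xnorm m B d A (realCombo Z g)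
        ∂(Measure.pi fun _ : Fin s ↦ ProbabilityTheory.gaussianReal 0 1))
      ∂(Measure.pi fun _ : Fin s ↦ Zdist d x) ≤ √K := by
    have hnonneg : ∀ Z : Fin s → Fin d → ℝ, 0 ≤ ∫ g, Xnorm m B d A (realCombo Z g)
        ∂(Measure.pi fun _ : Fin s ↦ ProbabilityTheory.gaussianReal 0 1) := fun Z ↦
      integral_nonneg fun g ↦ Real.iSup_nonneg fun b ↦ Real.sqrt_nonneg _
    refine integral_le_sqrt_of_sq_le
      (W := fun Z ↦ 2 * ((B : ℝ) * s) + 4 * L ^ 2 * Real.log m * W Z)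
      (ae_of_all _ hnonneg) ?_ ((integrable_const _).add (hWi.const_mul _)) ?_
    · filter_upwards [hsamp] with Z hZ
      have hb := integral_Xnorm_realCombo_le hA hL hx hZ (hW Z hZ).1 (hW Z hZ).2
      have h0 := (hW Z hZ).1
      refine (pow_le_pow_left₀ (hnonneg Z) hb 2).trans ?_
      rw [Real.sq_sqrt (by positivity)]
      exact le_of_eq (by ring)
    · rw [integral_add (integrable_const _) (hWi.const_mul _), integral_const, integral_const_mul]
      simp only [probReal_univ, smul_eq_mul, one_mul, hK]
      gcongr
  refine hmain.trans (Real.sqrt_le_iff.2 ⟨by positivity, ?_⟩)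
  have e1 : √((B : ℝ) * s) ^ 2 = B * s := Real.sq_sqrt (by positivity)
  have e2 : (√(Real.log m) * L * √(s * M + Real.log k)) ^ 2 =
      Real.log m * L ^ 2 * (s * M + Real.log k) := by
    rw [mul_pow, mul_pow, Real.sq_sqrt hm, Real.sq_sqrt (by positivity)]
  have h1 : 0 ≤ √((B : ℝ) * s) := Real.sqrt_nonneg _
  have h2 : 0 ≤ √(Real.log m) * L * √(s * M + Real.log k) :=
    mul_nonneg hmL (Real.sqrt_nonneg _)
  have e3 : K = 2 * √((B : ℝ) * s) ^ 2 +
      8 * (√(Real.log m) * L * √(s * M + Real.log k)) ^ 2 := by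
    rw [e1, e2, hK]; ring
  rw [e3]
  nlinarith [mul_nonneg h1 h2]

end
end

section
/- Let A be drawn from the partial circulant ensemble on mB × d matrices. Then there exists an absolute constant C such that with probability at least 7/8 over the random signs defining A, for every s ∈ [2k] and every bucket b ∈ [m], sup_{x∈T_s} ‖A_b x‖₂ ≤ C(√B + √s · log k · log d). -/
open MeasureTheory Finset

noncomputable section

/-- A sign in {±1} from a boolean. -/
def sgn (s : Bool) : ℝ := if s then 1 else -1

/-- A draw from the partial circulant ensemble: the rows of the circulant matrix `H_ε`
(whose (i,j) entry is `ε_{i-j}`, indices mod d) indexed by `Ω`, where `ε ∈ {±1}^d`. -/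
def pcMatrix (M d : ℕ) (Ω : Fin M ↪ Fin d) (ε : Fin d → Bool) :
    Fin M → Fin d → ℂ :=
  fun r j => ((sgn (ε (Ω r - j)) : ℝ) : ℂ)

/-- Parseval's identity on a finite abelian group. -/
lemma sum_sq_norm_charSum {G : Type*} [AddCommGroup G] [Fintype G] (u : G → ℝ) :
    ∑ ψ : AddChar G ℂ, ‖∑ j, (u j : ℂ) * ψ j‖ ^ 2 = Fintype.card G * ∑ j, u j ^ 2 := by
  classical
  have key : ∀ ψ : AddChar G ℂ, ((‖∑ j, (u j : ℂ) * ψ j‖ ^ 2 : ℝ) : ℂ)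
      = ∑ j, ∑ k, ((u j : ℂ) * u k) * ψ (j - k) := by
    intro ψ
    rw [Complex.ofReal_pow, ← Complex.mul_conj', map_sum, Finset.sum_mul_sum]
    refine Finset.sum_congr rfl fun j _ => Finset.sum_congr rfl fun k _ => ?_
    rw [map_mul, Complex.conj_ofReal, ← AddChar.map_neg_eq_conj, sub_eq_add_neg,
      AddChar.map_add_eq_mul]
    ring
  have h : ((∑ ψ : AddChar G ℂ, ‖∑ j, (u j : ℂ) * ψ j‖ ^ 2 : ℝ) : ℂ)
      = ((Fintype.card G * ∑ j, u j ^ 2 : ℝ) : ℂ) := by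
    rw [Complex.ofReal_sum, Finset.sum_congr rfl fun ψ _ => key ψ, Finset.sum_comm]
    push_cast
    rw [Finset.mul_sum]
    refine Finset.sum_congr rfl fun j _ => ?_
    rw [Finset.sum_comm]
    simp_rw [← Finset.mul_sum, AddChar.sum_apply_eq_ite, sub_eq_zero]
    simp
    ring
  exact_mod_cast h

lemma charSum_conv {G : Type*} [AddCommGroup G] [Fintype G] (x u : G → ℝ) (ψ : AddChar G ℂ) :
    ∑ i, ((∑ j, x j * u (i - j) : ℝ) : ℂ) * ψ i
      = (∑ j, (x j : ℂ) * ψ j) * ∑ j, (u j : ℂ) * ψ j := by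
  simp only [Complex.ofReal_sum, Complex.ofReal_mul, Finset.sum_mul]
  rw [Finset.sum_comm]
  refine Finset.sum_congr rfl fun j _ => ?_
  rw [Finset.mul_sum]
  refine Fintype.sum_equiv (Equiv.subRight j) _ _ fun i => ?_
  have : ψ i = ψ j * ψ (i - j) := by rw [← AddChar.map_add_eq_mul]; congr 1; abel
  simp only [Equiv.subRight_apply, this]
  ring

/-- Convolution by `x` has `ℓ²` operator norm at most the sup norm of the Fourier transform. -/
lemma sum_sq_conv_le {G : Type*} [AddCommGroup G] [Fintype G] (x u : G → ℝ) {r : ℝ}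
    (h : ∀ ψ : AddChar G ℂ, ‖∑ j, (x j : ℂ) * ψ j‖ ≤ r) :
    ∑ i, (∑ j, x j * u (i - j)) ^ 2 ≤ r ^ 2 * ∑ j, u j ^ 2 := by
  have hN : (0 : ℝ) < Fintype.card G := by exact_mod_cast Fintype.card_pos
  refine le_of_mul_le_mul_left ?_ hN
  rw [← sum_sq_norm_charSum fun i => ∑ j, x j * u (i - j)]
  calc _ ≤ ∑ ψ : AddChar G ℂ, r ^ 2 * ‖∑ j, (u j : ℂ) * ψ j‖ ^ 2 := by
        refine Finset.sum_le_sum fun ψ _ => ?_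
        rw [charSum_conv, norm_mul, mul_pow]
        gcongr
        exact h ψ
    _ = _ := by rw [← Finset.mul_sum, sum_sq_norm_charSum]; ring

lemma sum_sq_le_of_charSum_le {G : Type*} [AddCommGroup G] [Fintype G] (x : G → ℝ) {r : ℝ}
    (h : ∀ ψ : AddChar G ℂ, ‖∑ j, (x j : ℂ) * ψ j‖ ≤ r) : ∑ j, x j ^ 2 ≤ r ^ 2 := by
  classical
  have := sum_sq_conv_le x (fun j => if j = 0 then 1 else 0) h
  simpa [sub_eq_zero] using this

lemma exp_le_cosh_add {K y : ℝ} (hK : 0 < K) (hy : |y| ≤ K) :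
    Real.exp y ≤ Real.cosh K + y / K * Real.sinh K := by
  obtain ⟨h1, h2⟩ := abs_le.mp hy
  have ha : 0 ≤ (1 + y / K) / 2 := by
    have : -1 ≤ y / K := by rw [le_div_iff₀ hK]; linarith
    linarith
  have hb : 0 ≤ (1 - y / K) / 2 := by
    have : y / K ≤ 1 := by rw [div_le_iff₀ hK]; linarith
    linarith
  have := convexOn_exp.2 (Set.mem_univ K) (Set.mem_univ (-K)) ha hb (by ring)
  have e : ((1 + y / K) / 2) • K + ((1 - y / K) / 2) • (-K) = y := by
    simp only [smul_eq_mul]; field_simp; ring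
  rw [e] at this
  rw [Real.cosh_eq, Real.sinh_eq]
  simp only [smul_eq_mul] at this
  linarith

/-- Hoeffding's lemma for a finitely supported mean-zero distribution. -/
lemma sum_mul_exp_le {ι : Type*} [Fintype ι] {p y : ι → ℝ} (hp : ∀ α, 0 ≤ p α)
    (hp1 : ∑ α, p α = 1) (hy : ∑ α, p α * y α = 0) {K : ℝ} (hK : 0 < K) (hyK : ∀ α, |y α| ≤ K) :
    ∑ α, p α * Real.exp (y α) ≤ Real.exp (K ^ 2 / 2) := by
  calc ∑ α, p α * Real.exp (y α)
      ≤ ∑ α, p α * (Real.cosh K + y α / K * Real.sinh K) :=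
        Finset.sum_le_sum fun α _ => mul_le_mul_of_nonneg_left (exp_le_cosh_add hK (hyK α)) (hp α)
    _ = (∑ α, p α) * Real.cosh K + (∑ α, p α * y α) * (Real.sinh K / K) := by
        rw [Finset.sum_mul, Finset.sum_mul, ← Finset.sum_add_distrib]
        refine Finset.sum_congr rfl fun α _ => ?_
        ring
    _ = Real.cosh K := by rw [hp1, hy]; ring
    _ ≤ _ := Real.cosh_le_exp_half_sq K

lemma exists_potential_le {ι κ : Type*} [Fintype ι] [Fintype κ] {p : ι → ℝ} {a : ι → κ → ℝ}
    (hp : ∀ α, 0 ≤ p α) (hp1 : ∑ α, p α = 1) (hmean : ∀ c, ∑ α, p α * a α c = 0)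
    {K l : ℝ} (hK : 0 < K) (hl : 0 < l) (ha : ∀ α c, |a α c| ≤ K) (L : ℕ) :
    ∃ f : Fin L → ι,
      ∑ c, (Real.exp (l * ∑ i, a (f i) c) + Real.exp (-(l * ∑ i, a (f i) c)))
        ≤ 2 * Fintype.card κ * Real.exp (L * ((l * K) ^ 2 / 2)) := by
  induction L with
  | zero =>
    refine ⟨Fin.elim0, ?_⟩
    simp
    linarith
  | succ L ih =>
    obtain ⟨f, hf⟩ := ih
    set w : κ → ℝ := fun c => l * ∑ i, a (f i) c with hw
    have hlK : 0 < l * K := mul_pos hl hK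
    have step : ∑ α, p α * ∑ c, (Real.exp (w c + l * a α c) + Real.exp (-(w c + l * a α c)))
        ≤ Real.exp ((l * K) ^ 2 / 2) * ∑ c, (Real.exp (w c) + Real.exp (-(w c))) := by
      simp_rw [Finset.mul_sum]
      rw [Finset.sum_comm]
      refine Finset.sum_le_sum fun c _ => ?_
      have h1 := sum_mul_exp_le (y := fun α => l * a α c) hp hp1
        (by rw [← mul_zero l, ← hmean c, Finset.mul_sum]
            exact Finset.sum_congr rfl fun α _ => by ring) hlK
        (fun α => by rw [abs_mul, abs_of_pos hl]; gcongr; exact ha α c)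
      have h2 := sum_mul_exp_le (y := fun α => -(l * a α c)) hp hp1
        (by rw [← mul_zero (-l), ← hmean c, Finset.mul_sum]
            exact Finset.sum_congr rfl fun α _ => by ring) hlK
        (fun α => by rw [abs_neg, abs_mul, abs_of_pos hl]; gcongr; exact ha α c)
      calc ∑ α, p α * (Real.exp (w c + l * a α c) + Real.exp (-(w c + l * a α c)))
          = Real.exp (w c) * ∑ α, p α * Real.exp (l * a α c)
            + Real.exp (-(w c)) * ∑ α, p α * Real.exp (-(l * a α c)) := by
            rw [Finset.mul_sum, Finset.mul_sum, ← Finset.sum_add_distrib]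
            refine Finset.sum_congr rfl fun α _ => ?_
            rw [neg_add, Real.exp_add, Real.exp_add]
            ring
        _ ≤ Real.exp (w c) * Real.exp ((l * K) ^ 2 / 2)
            + Real.exp (-(w c)) * Real.exp ((l * K) ^ 2 / 2) := by gcongr
        _ = _ := by ring
    obtain ⟨α, hα⟩ : ∃ α, ∑ c, (Real.exp (w c + l * a α c) + Real.exp (-(w c + l * a α c)))
        ≤ Real.exp ((l * K) ^ 2 / 2) * ∑ c, (Real.exp (w c) + Real.exp (-(w c))) := by
      by_contra! hcon
      have hpos : ∃ α ∈ (Finset.univ : Finset ι), 0 < p α := by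
        by_contra! h0
        have := Finset.sum_nonpos h0
        linarith
      obtain ⟨α₀, -, hα₀⟩ := hpos
      refine absurd step (not_le.mpr ?_)
      calc _ = ∑ α, p α *
            (Real.exp ((l * K) ^ 2 / 2) * ∑ c, (Real.exp (w c) + Real.exp (-(w c)))) := by
            rw [← Finset.sum_mul, hp1, one_mul]
        _ < _ := Finset.sum_lt_sum
            (fun α _ => mul_le_mul_of_nonneg_left (hcon α).le (hp α))
            ⟨α₀, Finset.mem_univ _, mul_lt_mul_of_pos_left (hcon α₀) hα₀⟩
    refine ⟨Fin.cons α f, ?_⟩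
    have e : ∀ c, l * ∑ i, a ((Fin.cons α f : Fin (L + 1) → ι) i) c = w c + l * a α c := by
      intro c
      rw [Fin.sum_univ_succ]
      simp [hw]
      ring
    simp_rw [e]
    refine hα.trans ?_
    calc _ ≤ Real.exp ((l * K) ^ 2 / 2)
          * (2 * Fintype.card κ * Real.exp (L * ((l * K) ^ 2 / 2))) := by gcongr
      _ = _ := by
        rw [mul_left_comm, ← Real.exp_add]
        congr 2
        push_cast
        ring

/-- Maurey's empirical method: a mean over `p` is approximated by an empirical mean,
simultaneously in finitely many coordinates. -/
lemma exists_empirical {ι κ : Type*} [Fintype ι] [Fintype κ] {p : ι → ℝ} {a : ι → κ → ℝ}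
    (hp : ∀ α, 0 ≤ p α) (hp1 : ∑ α, p α = 1) (ha : ∀ α c, |a α c| ≤ 1) {L : ℕ} (hL : 0 < L)
    {Λ : ℝ} (hΛ : 0 < Λ) (hκ : Real.log (2 * Fintype.card κ) ≤ Λ) :
    ∃ f : Fin L → ι, ∀ c, |(∑ i, a (f i) c) - L * ∑ α, p α * a α c| ≤ 2 * √(2 * L * Λ) := by
  have hL' : (0 : ℝ) < L := by exact_mod_cast hL
  have hm : ∀ c, |∑ α, p α * a α c| ≤ 1 := fun c => by
    calc _ ≤ ∑ α, |p α * a α c| := Finset.abs_sum_le_sum_abs _ _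
      _ ≤ ∑ α, p α := Finset.sum_le_sum fun α _ => by
          rw [abs_mul, abs_of_nonneg (hp α)]
          exact mul_le_of_le_one_right (hp α) (ha α c)
      _ = 1 := hp1
  set l : ℝ := √(Λ / (2 * L)) with hl
  have hlpos : 0 < l := Real.sqrt_pos.mpr (by positivity)
  have hl2 : l ^ 2 = Λ / (2 * L) := Real.sq_sqrt (by positivity)
  obtain ⟨f, hf⟩ := exists_potential_le (a := fun α c => a α c - ∑ α, p α * a α c) hp hp1
    (fun c => by simp_rw [mul_sub, Finset.sum_sub_distrib, ← Finset.sum_mul, hp1]; ring)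
    (K := 2) (by norm_num) hlpos
    (fun α c => (abs_sub _ _).trans (by linarith [ha α c, hm c])) L
  refine ⟨f, fun c => ?_⟩
  have e : ∑ i, (a (f i) c - ∑ α, p α * a α c) = (∑ i, a (f i) c) - L * ∑ α, p α * a α c := by
    simp
  set y : ℝ := (∑ i, a (f i) c) - L * ∑ α, p α * a α c with hy
  have hcard : (0 : ℝ) < Fintype.card κ := by
    exact_mod_cast Fintype.card_pos_iff.mpr ⟨c⟩
  have h1 : Real.exp |l * y| ≤ 2 * Fintype.card κ * Real.exp (L * ((l * 2) ^ 2 / 2)) := by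
    refine le_trans ?_ hf
    refine le_trans ?_ (Finset.single_le_sum (f := fun c => _) (fun c _ => by positivity)
      (Finset.mem_univ c))
    simp only [e]
    rcases abs_cases (l * y) with h | h <;> rw [h.1]
    · linarith [Real.exp_pos (-(l * y))]
    · linarith [Real.exp_pos (l * y)]
  have h2 : |l * y| ≤ Λ + L * ((l * 2) ^ 2 / 2) := by
    have := Real.log_le_log (Real.exp_pos _) h1
    rw [Real.log_exp, Real.log_mul (by positivity) (Real.exp_pos _).ne', Real.log_exp] at this
    linarith
  have h3 : L * ((l * 2) ^ 2 / 2) = Λ := by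
    rw [mul_pow, hl2]; field_simp
  rw [h3, abs_mul, abs_of_pos hlpos] at h2
  have h4 : l * (2 * √(2 * L * Λ)) = Λ + Λ := by
    have : l * √(2 * L * Λ) = Λ := by
      rw [hl, ← Real.sqrt_mul (by positivity), show Λ / (2 * L) * (2 * L * Λ) = Λ ^ 2 by
        field_simp, Real.sqrt_sq hΛ.le]
    linarith
  exact le_of_mul_le_mul_left (by linarith) hlpos

/-- The real sign vector of a Boolean vector. -/
def signVec {G : Type*} (ε : G → Bool) : G → ℝ := fun l => sgn (ε l)

lemma sgn_not (a : Bool) : sgn (!a) = -sgn a := by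
  cases a <;> simp [sgn]

lemma sgn_sq (a : Bool) : sgn a ^ 2 = 1 := by
  cases a <;> simp [sgn]

lemma abs_sgn (a : Bool) : |sgn a| = 1 := by
  cases a <;> simp [sgn]

lemma sum_exp_sgn_le {G : Type*} [Fintype G] [DecidableEq G] (b : G → ℝ) :
    ∑ σ : G → Bool, Real.exp (∑ l, sgn (σ l) * b l)
      ≤ Fintype.card (G → Bool) * Real.exp ((∑ l, b l ^ 2) / 2) := by
  simp_rw [Real.exp_sum]
  rw [← Fintype.prod_sum fun l x => Real.exp (sgn x * b l), Fintype.card_fun, Fintype.card_bool,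
    Finset.sum_div, Real.exp_sum]
  push_cast
  rw [← Finset.card_univ, ← Finset.prod_const, ← Finset.prod_mul_distrib]
  refine Finset.prod_le_prod (fun l _ => by positivity) fun l _ => ?_
  have := Real.cosh_le_exp_half_sq (b l)
  rw [Real.cosh_eq] at this
  simp [sgn]
  linarith

/-- Hoeffding's inequality for Rademacher sums. -/
lemma card_rademacher_le {G : Type*} [Fintype G] [DecidableEq G] (b : G → ℝ) {v t : ℝ}
    (hv : 0 ≤ v) (ht : 0 ≤ t) (hb : ∑ l, b l ^ 2 ≤ v ^ 2) :
    ((Finset.univ.filter fun σ : G → Bool => t * v < |∑ l, sgn (σ l) * b l|).card : ℝ)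
      ≤ 2 * Real.exp (-(t ^ 2 / 2)) * Fintype.card (G → Bool) := by
  rcases hv.eq_or_lt with rfl | hv
  · have h0 : ∀ l, b l = 0 := fun l => by
      have := Finset.single_le_sum (fun l _ => sq_nonneg (b l)) (Finset.mem_univ l)
      exact pow_eq_zero_iff two_ne_zero |>.mp (le_antisymm (by linarith) (sq_nonneg _))
    simp [h0]
    positivity
  have hmgf : ∀ l : ℝ, l ^ 2 = (t / v) ^ 2 →
      ∑ σ : G → Bool, Real.exp (l * ∑ i, sgn (σ i) * b i)
        ≤ Fintype.card (G → Bool) * Real.exp (t ^ 2 / 2) := by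
    intro l hl
    have := sum_exp_sgn_le fun i => l * b i
    simp_rw [mul_left_comm _ l, ← Finset.mul_sum] at this
    refine this.trans ?_
    gcongr
    simp_rw [mul_pow, ← Finset.mul_sum, hl]
    calc (t / v) ^ 2 * ∑ i, b i ^ 2 ≤ (t / v) ^ 2 * v ^ 2 := by gcongr
      _ = t ^ 2 := by field_simp
  have hcount : ((Finset.univ.filter fun σ : G → Bool => t * v < |∑ l, sgn (σ l) * b l|).card : ℝ)
      * Real.exp (t ^ 2) ≤ ∑ σ : G → Bool, (Real.exp (t / v * ∑ i, sgn (σ i) * b i)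
        + Real.exp (-(t / v) * ∑ i, sgn (σ i) * b i)) := by
    rw [← nsmul_eq_mul]
    refine (Finset.card_nsmul_le_sum _ _ _ fun σ hσ => ?_).trans
      (Finset.sum_le_univ_sum_of_nonneg fun σ => by positivity)
    have hσ' : t * v < |∑ l, sgn (σ l) * b l| := (Finset.mem_filter.mp hσ).2
    have h1 : t ^ 2 ≤ t / v * |∑ l, sgn (σ l) * b l| := by
      calc t ^ 2 = t / v * (t * v) := by field_simp
        _ ≤ _ := by gcongr
    rcases abs_cases (∑ l, sgn (σ l) * b l) with h | h <;> rw [h.1] at h1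
    · exact (Real.exp_le_exp.mpr h1).trans (le_add_of_nonneg_right (by positivity))
    · rw [← neg_mul_comm] at h1
      exact (Real.exp_le_exp.mpr h1).trans (le_add_of_nonneg_left (by positivity))
  rw [Finset.sum_add_distrib] at hcount
  have h := hcount.trans (add_le_add (hmgf _ rfl) (hmgf _ (by ring)))
  have he : Real.exp (t ^ 2 / 2) = Real.exp (-(t ^ 2 / 2)) * Real.exp (t ^ 2) := by
    rw [← Real.exp_add]; congr 1; ring
  refine le_of_mul_le_mul_right (h.trans_eq ?_) (Real.exp_pos (t ^ 2))
  rw [he]; ring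

/-- Flip both signs where they agree, keeping the difference of the two sign vectors. -/
def agreeFlip {G : Type*} (σ : G → Bool) (p : (G → Bool) × (G → Bool)) :
    (G → Bool) × (G → Bool) :=
  (fun l => if p.1 l = p.2 l then p.1 l == σ l else p.1 l,
   fun l => if p.1 l = p.2 l then p.2 l == σ l else p.2 l)

lemma agreeFlip_involutive {G : Type*} (σ : G → Bool) : Function.Involutive (agreeFlip σ) := by
  rintro ⟨p, q⟩
  simp only [agreeFlip, Prod.mk.injEq]
  constructor <;> funext l <;> cases p l <;> cases q l <;> cases σ l <;> simp

lemma agreeFlip_add {G : Type*} (σ : G → Bool) (p : (G → Bool) × (G → Bool)) (l : G) :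
    signVec (agreeFlip σ p).1 l + signVec (agreeFlip σ p).2 l
      = sgn (σ l) * (signVec p.1 l + signVec p.2 l) := by
  simp only [agreeFlip, signVec]
  cases p.1 l <;> cases p.2 l <;> cases σ l <;> simp [sgn]

lemma agreeFlip_sub {G : Type*} (σ : G → Bool) (p : (G → Bool) × (G → Bool)) :
    signVec (agreeFlip σ p).1 - signVec (agreeFlip σ p).2 = signVec p.1 - signVec p.2 := by
  funext l
  simp only [agreeFlip, signVec, Pi.sub_apply]
  cases p.1 l <;> cases p.2 l <;> cases σ l <;> simp [sgn]

/-- The sum of two independent sign vectors is subgaussian conditionally on their difference. -/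
lemma card_pair_le {G : Type*} [Fintype G] [DecidableEq G] (a : (G → ℝ) → G → ℝ) {t : ℝ}
    (ht : 0 ≤ t) :
    ((Finset.univ.filter fun p : (G → Bool) × (G → Bool) =>
        t * (2 * √(∑ l, a (signVec p.1 - signVec p.2) l ^ 2))
          < |∑ l, (signVec p.1 + signVec p.2) l * a (signVec p.1 - signVec p.2) l|).card : ℝ)
      ≤ 2 * Real.exp (-(t ^ 2 / 2)) * Fintype.card (G → Bool) ^ 2 := by
  set P : (G → Bool) × (G → Bool) → Prop := fun p =>
    t * (2 * √(∑ l, a (signVec p.1 - signVec p.2) l ^ 2))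
      < |∑ l, (signVec p.1 + signVec p.2) l * a (signVec p.1 - signVec p.2) l| with hP
  have hn : (0 : ℝ) < Fintype.card (G → Bool) := by exact_mod_cast Fintype.card_pos
  have hflip : ∀ σ : G → Bool, ((Finset.univ.filter P).card : ℝ)
      = ∑ p, if P (agreeFlip σ p) then (1 : ℝ) else 0 := fun σ => by
    rw [Finset.card_filter]
    push_cast
    exact (Fintype.sum_equiv (agreeFlip_involutive σ).toPerm _ _ fun p => rfl).symm
  have hcond : ∀ p, (∑ σ : G → Bool, if P (agreeFlip σ p) then (1 : ℝ) else 0)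
      ≤ 2 * Real.exp (-(t ^ 2 / 2)) * Fintype.card (G → Bool) := fun p => by
    refine le_trans (le_of_eq ?_) (card_rademacher_le
      (fun l => (signVec p.1 + signVec p.2) l * a (signVec p.1 - signVec p.2) l)
      (v := 2 * √(∑ l, a (signVec p.1 - signVec p.2) l ^ 2)) (by positivity) ht ?_)
    · rw [Finset.card_filter]
      push_cast
      refine Finset.sum_congr rfl fun σ _ => ?_
      simp only [hP, agreeFlip_sub, Pi.add_apply, agreeFlip_add, mul_assoc]
    · rw [mul_pow, Real.sq_sqrt (Finset.sum_nonneg fun _ _ => sq_nonneg _), Finset.mul_sum]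
      refine Finset.sum_le_sum fun l _ => ?_
      rw [mul_pow]
      refine mul_le_mul_of_nonneg_right ?_ (sq_nonneg _)
      rw [sq_le_sq, Pi.add_apply, abs_two]
      refine (abs_add_le _ _).trans ?_
      simp only [signVec, abs_sgn]
      norm_num
  refine le_of_mul_le_mul_right ?_ hn
  calc _ = ∑ _σ : G → Bool, ((Finset.univ.filter P).card : ℝ) := by
        rw [Finset.sum_const, Finset.card_univ, nsmul_eq_mul, mul_comm]
    _ = ∑ p, ∑ σ : G → Bool, if P (agreeFlip σ p) then (1 : ℝ) else 0 := by
        rw [Finset.sum_comm]; exact Finset.sum_congr rfl fun σ _ => hflip σ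
    _ ≤ ∑ _p : (G → Bool) × (G → Bool), 2 * Real.exp (-(t ^ 2 / 2)) * Fintype.card (G → Bool) :=
        Finset.sum_le_sum fun p _ => hcond p
    _ = _ := by
        rw [Finset.sum_const, Finset.card_univ, Fintype.card_prod, nsmul_eq_mul]
        push_cast
        ring

section Bilinear

variable {G E : Type*} [Fintype G] [DecidableEq G] [NormedAddCommGroup E] [InnerProductSpace ℝ E]

lemma sum_mul_inner_single (f : (G → ℝ) →ₗ[ℝ] E) (u : G → ℝ) (v : E) :
    ∑ l, u l * inner ℝ (f (Pi.single l 1)) v = inner ℝ (f u) v := by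
  conv_rhs => rw [LinearMap.pi_apply_eq_sum_univ f u, sum_inner]
  refine Finset.sum_congr rfl fun l _ => ?_
  rw [real_inner_smul_left]
  congr 4
  funext j
  simp [Pi.single_apply, eq_comm]

/-- The adjoint of `f` has the same `ℓ²` operator norm bound as `f`. -/
lemma sqrt_sum_sq_inner_single_le (f : (G → ℝ) →ₗ[ℝ] E) {ρ : ℝ} (hρ : 0 ≤ ρ)
    (h : ∀ u, ‖f u‖ ≤ ρ * √(∑ l, u l ^ 2)) (v : E) :
    √(∑ l, inner ℝ (f (Pi.single l 1)) v ^ 2) ≤ ρ * ‖v‖ := by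
  set a : G → ℝ := fun l => inner ℝ (f (Pi.single l 1)) v with ha
  set n : ℝ := √(∑ l, a l ^ 2) with hn
  have hn2 : n * n = ∑ l, a l ^ 2 := Real.mul_self_sqrt (Finset.sum_nonneg fun _ _ => sq_nonneg _)
  have h1 : n * n ≤ n * (ρ * ‖v‖) := by
    calc n * n = inner ℝ (f a) v := by
          rw [hn2, ← sum_mul_inner_single f a v]
          exact Finset.sum_congr rfl fun l _ => by rw [sq]
      _ ≤ ‖f a‖ * ‖v‖ := real_inner_le_norm _ _
      _ ≤ ρ * n * ‖v‖ := by gcongr; exact h a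
      _ = _ := by ring
  rcases (Real.sqrt_nonneg (∑ l, a l ^ 2)).eq_or_lt with h0 | h0
  · rw [← hn] at h0; rw [← h0]; positivity
  · exact le_of_mul_le_mul_left h1 h0

lemma card_inner_add_le (f g : (G → ℝ) →ₗ[ℝ] E) {ρ t : ℝ} (hρ : 0 ≤ ρ) (ht : 0 ≤ t)
    (h : ∀ u, ‖f u‖ ≤ ρ * √(∑ l, u l ^ 2)) :
    ((Finset.univ.filter fun p : (G → Bool) × (G → Bool) =>
        2 * t * ρ * ‖g (signVec p.1 - signVec p.2)‖
          < |inner ℝ (f (signVec p.1 + signVec p.2)) (g (signVec p.1 - signVec p.2))|).card : ℝ)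
      ≤ 2 * Real.exp (-(t ^ 2 / 2)) * Fintype.card (G → Bool) ^ 2 := by
  refine le_trans ?_ (card_pair_le (fun c l => inner ℝ (f (Pi.single l 1)) (g c)) ht)
  norm_cast
  refine Finset.card_le_card (Finset.monotone_filter_right _ fun p _ hp => ?_)
  simp only [sum_mul_inner_single]
  refine lt_of_le_of_lt ?_ hp
  have := sqrt_sum_sq_inner_single_le f hρ h (g (signVec p.1 - signVec p.2))
  calc _ = 2 * t * √(∑ l, inner ℝ (f (Pi.single l 1)) (g (signVec p.1 - signVec p.2)) ^ 2) := by
        ring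
    _ ≤ 2 * t * (ρ * ‖g (signVec p.1 - signVec p.2)‖) := by gcongr
    _ = _ := by ring

lemma card_inner_sub_le (f g : (G → ℝ) →ₗ[ℝ] E) {ρ t : ℝ} (hρ : 0 ≤ ρ) (ht : 0 ≤ t)
    (h : ∀ u, ‖f u‖ ≤ ρ * √(∑ l, u l ^ 2)) :
    ((Finset.univ.filter fun p : (G → Bool) × (G → Bool) =>
        2 * t * ρ * ‖g (signVec p.1 + signVec p.2)‖
          < |inner ℝ (f (signVec p.1 - signVec p.2)) (g (signVec p.1 + signVec p.2))|).card : ℝ)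
      ≤ 2 * Real.exp (-(t ^ 2 / 2)) * Fintype.card (G → Bool) ^ 2 := by
  refine le_trans (le_of_eq ?_) (card_inner_add_le f g hρ ht h)
  have hinv : Function.Involutive fun ε : G → Bool => fun l => !ε l := fun ε => by simp
  have hneg : ∀ ε : G → Bool, signVec (fun l => !ε l) = -signVec ε := fun ε => by
    funext l; simp [signVec, sgn_not]
  norm_cast
  refine Finset.card_bij' (fun p _ => (p.1, fun l => !p.2 l)) (fun p _ => (p.1, fun l => !p.2 l))
    ?_ ?_ (fun p _ => by simp) (fun p _ => by simp) <;>
  · intro p hp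
    simpa [hneg, sub_eq_add_neg] using hp

end Bilinear

/-- Self-bounding by symmetrization: if the squares of a nonnegative process at two independent
points differ by at most a multiple of the two suprema, off a small exceptional set,
then the supremum is small with high probability. -/
lemma card_sup_gt_le {S X : Type*} [Fintype S] [Nonempty S] {T : Set X} (hT : T.Nonempty)
    {F : X → S → ℝ} (hF : ∀ x ε, 0 ≤ F x ε) {Q B Γ η : ℝ} (hB : 0 < B) (hΓ : 0 ≤ Γ)
    (hQ : ∀ x ∈ T, ∀ ε, F x ε ^ 2 ≤ Q) (hF2 : ∀ x ∈ T, ∑ ε, F x ε ^ 2 ≤ B * Fintype.card S)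
    {Bad : S × S → Prop} [DecidablePred Bad]
    (hgood : ∀ p, ¬ Bad p → ∀ M M' : ℝ, (∀ x ∈ T, F x p.1 ≤ M) → (∀ x ∈ T, F x p.2 ≤ M') →
      ∀ x ∈ T, F x p.1 ^ 2 - F x p.2 ^ 2 ≤ 2 * Γ * (M + M'))
    (hbad : ((Finset.univ.filter Bad).card : ℝ) ≤ η * Fintype.card S ^ 2) (hη : Q * η ≤ B)
    [DecidablePred fun ε => ∃ x ∈ T, 6 * (Γ + √B) < F x ε] :
    ((Finset.univ.filter fun ε => ∃ x ∈ T, 6 * (Γ + √B) < F x ε).card : ℝ) * B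
      ≤ Q * η * Fintype.card S := by
  classical
  set n : ℝ := ((Fintype.card S : ℕ) : ℝ) with hn
  have hn0 : 0 < n := by rw [hn]; exact_mod_cast Fintype.card_pos
  have hQ0 : 0 ≤ Q := by
    obtain ⟨x, hx⟩ := hT
    exact (sq_nonneg _).trans (hQ x hx (Classical.arbitrary S))
  set M : S → ℝ := fun ε => sSup ((fun x => F x ε) '' T) with hM
  have hbdd : ∀ ε, BddAbove ((fun x => F x ε) '' T) := fun ε => by
    refine ⟨√Q, ?_⟩
    rintro _ ⟨x, hx, rfl⟩
    exact Real.le_sqrt_of_sq_le (hQ x hx ε)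
  have hle : ∀ ε, ∀ x ∈ T, F x ε ≤ M ε := fun ε x hx => le_csSup (hbdd ε) ⟨x, hx, rfl⟩
  have hM0 : ∀ ε, 0 ≤ M ε := fun ε => by
    obtain ⟨x, hx⟩ := hT
    exact (hF x ε).trans (hle ε x hx)
  have hlub : ∀ ε c, (∀ x ∈ T, F x ε ≤ c) → M ε ≤ c := fun ε c h => by
    refine csSup_le (hT.image _) ?_
    rintro _ ⟨x, hx, rfl⟩
    exact h x hx
  set m : ℝ := (∑ ε, M ε) / n with hm
  have hmn : ∑ ε, M ε = m * n := by rw [hm]; field_simp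
  have hm0 : 0 ≤ m := div_nonneg (Finset.sum_nonneg fun ε _ => hM0 ε) hn0.le
  set g : S → ℝ := fun ε => (∑ ε', if Bad (ε, ε') then (1 : ℝ) else 0) / n with hg
  have hg0 : ∀ ε, 0 ≤ g ε := fun ε => by positivity
  have hgn : ∀ ε, (∑ ε', if Bad (ε, ε') then (1 : ℝ) else 0) = g ε * n := fun ε => by
    simp only [hg]; field_simp
  have hgsum : ∑ ε, g ε ≤ η * n := by
    refine le_of_mul_le_mul_right ?_ hn0
    rw [Finset.sum_mul, ← Finset.sum_congr rfl fun ε _ => hgn ε]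
    calc _ = ((Finset.univ.filter Bad).card : ℝ) := by
          rw [Finset.card_filter, Nat.cast_sum, Fintype.sum_prod_type]
          push_cast
          rfl
      _ ≤ _ := hbad.trans_eq (by ring)
  have hpt : ∀ ε, M ε ^ 2 ≤ 2 * Γ * (M ε + m) + Q * g ε + B := by
    intro ε
    have hR : 0 ≤ 2 * Γ * (M ε + m) + Q * g ε + B := by
      have := hM0 ε; have := hg0 ε; positivity
    rw [← Real.le_sqrt (hM0 ε) hR]
    refine hlub ε _ fun x hx => Real.le_sqrt_of_sq_le ?_
    refine le_of_mul_le_mul_right ?_ hn0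
    have h1 : ∀ ε', F x ε ^ 2 ≤ F x ε' ^ 2 + 2 * Γ * (M ε + M ε')
        + Q * (if Bad (ε, ε') then (1 : ℝ) else 0) := by
      intro ε'
      split_ifs with hb
      · have := hQ x hx ε
        have : 0 ≤ 2 * Γ * (M ε + M ε') := by
          have := hM0 ε; have := hM0 ε'; positivity
        nlinarith [sq_nonneg (F x ε')]
      · have := hgood _ hb _ _ (hle ε) (hle ε') x hx
        simp only at this
        linarith
    calc F x ε ^ 2 * n = ∑ _ε' : S, F x ε ^ 2 := by
          rw [Finset.sum_const, Finset.card_univ, nsmul_eq_mul, mul_comm]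
      _ ≤ ∑ ε', (F x ε' ^ 2 + 2 * Γ * (M ε + M ε')
          + Q * (if Bad (ε, ε') then (1 : ℝ) else 0)) := Finset.sum_le_sum fun ε' _ => h1 ε'
      _ = ∑ ε', F x ε' ^ 2 + 2 * Γ * (n * M ε + m * n) + Q * (g ε * n) := by
          rw [Finset.sum_add_distrib, Finset.sum_add_distrib, ← Finset.mul_sum, ← Finset.mul_sum,
            Finset.sum_add_distrib, Finset.sum_const, Finset.card_univ, nsmul_eq_mul, hmn, hgn]
      _ ≤ B * n + 2 * Γ * (n * M ε + m * n) + Q * (g ε * n) := by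
          gcongr; exact hF2 x hx
      _ = _ := by ring
  have hmsq : m ^ 2 ≤ 4 * Γ * m + 2 * B := by
    have h1 : (∑ ε, M ε) ^ 2 ≤ n * ∑ ε, M ε ^ 2 := by
      have := sq_sum_le_card_mul_sum_sq (s := (Finset.univ : Finset S)) (f := M)
      rwa [Finset.card_univ] at this
    have h2 : ∑ ε, M ε ^ 2 ≤ n * (4 * Γ * m + 2 * B) := by
      calc _ ≤ ∑ ε, (2 * Γ * (M ε + m) + Q * g ε + B) := Finset.sum_le_sum fun ε _ => hpt ε
        _ = 2 * Γ * (m * n + n * m) + Q * ∑ ε, g ε + n * B := by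
            rw [Finset.sum_add_distrib, Finset.sum_add_distrib, ← Finset.mul_sum, ← Finset.mul_sum,
              Finset.sum_add_distrib, Finset.sum_const, Finset.sum_const, Finset.card_univ,
              nsmul_eq_mul, nsmul_eq_mul, hmn]
        _ ≤ 2 * Γ * (m * n + n * m) + Q * (η * n) + n * B := by gcongr
        _ ≤ _ := by nlinarith
    rw [hmn] at h1
    refine le_of_mul_le_mul_right ?_ (by positivity : 0 < n ^ 2)
    nlinarith
  have hs : √B ^ 2 = B := Real.sq_sqrt hB.le
  have hs0 : 0 < √B := Real.sqrt_pos.mpr hB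
  have hm1 : m ≤ 4 * Γ + 2 * √B := by
    by_contra! hcon
    nlinarith
  have hsmall : ∀ ε, Q * g ε ≤ B → M ε ≤ 6 * (Γ + √B) := by
    intro ε hε
    by_contra! hcon
    have h1 := hpt ε
    have h2 : 2 * Γ * m ≤ 2 * Γ * (4 * Γ + 2 * √B) := by gcongr
    nlinarith [mul_pos hs0 hs0, mul_nonneg hΓ hs0.le, mul_nonneg hΓ hΓ]
  calc _ = ∑ _ε ∈ Finset.univ.filter (fun ε => ∃ x ∈ T, 6 * (Γ + √B) < F x ε), B := by
        rw [Finset.sum_const, nsmul_eq_mul]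
    _ ≤ ∑ ε ∈ Finset.univ.filter (fun ε => ∃ x ∈ T, 6 * (Γ + √B) < F x ε), Q * g ε := by
        refine Finset.sum_le_sum fun ε hε => ?_
        obtain ⟨x, hx, hlt⟩ := (Finset.mem_filter.mp hε).2
        by_contra! hcon
        exact absurd (hsmall ε hcon.le) (not_le.mpr (hlt.trans_le (hle ε x hx)))
    _ ≤ ∑ ε, Q * g ε := Finset.sum_le_univ_sum_of_nonneg fun ε => mul_nonneg hQ0 (hg0 ε)
    _ ≤ Q * (η * n) := by rw [← Finset.mul_sum]; gcongr
    _ = _ := by ring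

section Chaining

variable {G E : Type*} [NormedAddCommGroup E] [InnerProductSpace ℝ E]

lemma abs_inner_chain_le (β : (G → ℝ) →ₗ[ℝ] (G → ℝ) →ₗ[ℝ] E) (a c : G → ℝ) {J : ℕ}
    {y : ℕ → G → ℝ} (hy : y 0 = 0) {τ : ℕ → ℝ} {Ma Mc : ℝ}
    (h1 : ∀ j < J, |inner ℝ (β (y (j + 1) - y j) a) (β (y (j + 1)) c)| ≤ τ j * Mc)
    (h2 : ∀ j < J, |inner ℝ (β (y (j + 1) - y j) c) (β (y j) a)| ≤ τ j * Ma) :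
    |inner ℝ (β (y J) a) (β (y J) c)| ≤ (∑ j ∈ Finset.range J, τ j) * (Ma + Mc) := by
  induction J with
  | zero => simp [hy]
  | succ J ih =>
    have ih := ih (fun j hj => h1 j (hj.trans (Nat.lt_succ_self J)))
      fun j hj => h2 j (hj.trans (Nat.lt_succ_self J))
    have h1 := h1 J (Nat.lt_succ_self J)
    have h2 := h2 J (Nat.lt_succ_self J)
    have e : inner ℝ (β (y (J + 1)) a) (β (y (J + 1)) c)
        = inner ℝ (β (y J) a) (β (y J) c)
          + (inner ℝ (β (y (J + 1) - y J) a) (β (y (J + 1)) c)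
            + inner ℝ (β (y (J + 1) - y J) c) (β (y J) a)) := by
      rw [real_inner_comm (β (y J) a) (β (y (J + 1) - y J) c)]
      simp only [map_sub, LinearMap.sub_apply, inner_sub_left, inner_sub_right]
      ring
    rw [e, Finset.sum_range_succ]
    refine (abs_add_le _ _).trans ?_
    have := abs_add_le (inner ℝ (β (y (J + 1) - y J) a) (β (y (J + 1)) c))
      (inner ℝ (β (y (J + 1) - y J) c) (β (y J) a))
    linarith

lemma norm_sq_sub_norm_sq_le (β : (G → ℝ) →ₗ[ℝ] (G → ℝ) →ₗ[ℝ] E) {T : Set (G → ℝ)} {p q : G → ℝ}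
    {M M' : ℝ} (hM : ∀ x ∈ T, ‖β x p‖ ≤ M) (hM' : ∀ x ∈ T, ‖β x q‖ ≤ M')
    {J : ℕ} {y : ℕ → G → ℝ} (hyT : ∀ j, y j ∈ T) (hy : y 0 = 0) {τ : ℕ → ℝ} (hτ : ∀ j, 0 ≤ τ j)
    {κ : ℝ}
    (h1 : ∀ j < J, |inner ℝ (β (y (j + 1) - y j) (p + q)) (β (y (j + 1)) (p - q))|
      ≤ τ j * ‖β (y (j + 1)) (p - q)‖)
    (h2 : ∀ j < J, |inner ℝ (β (y (j + 1) - y j) (p - q)) (β (y j) (p + q))|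
      ≤ τ j * ‖β (y j) (p + q)‖)
    {x : G → ℝ} (hx : x ∈ T) (ha : ‖β (x - y J) (p + q)‖ ≤ κ) (hc : ‖β (x - y J) (p - q)‖ ≤ κ) :
    ‖β x p‖ ^ 2 - ‖β x q‖ ^ 2
      ≤ 2 * ((∑ j ∈ Finset.range J, τ j) + κ) * (M + M') := by
  have hadd : ∀ z ∈ T, ‖β z (p + q)‖ ≤ M + M' := fun z hz => by
    rw [map_add]; exact (norm_add_le _ _).trans (add_le_add (hM z hz) (hM' z hz))
  have hsub : ∀ z ∈ T, ‖β z (p - q)‖ ≤ M + M' := fun z hz => by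
    rw [map_sub]; exact (norm_sub_le _ _).trans (add_le_add (hM z hz) (hM' z hz))
  have hch := abs_inner_chain_le β (p + q) (p - q) hy
    (fun j hj => (h1 j hj).trans (mul_le_mul_of_nonneg_left (hsub _ (hyT _)) (hτ j)))
    (fun j hj => (h2 j hj).trans (mul_le_mul_of_nonneg_left (hadd _ (hyT _)) (hτ j)))
  have e : ‖β x p‖ ^ 2 - ‖β x q‖ ^ 2 = inner ℝ (β (y J) (p + q)) (β (y J) (p - q))
      + inner ℝ (β (x - y J) (p + q)) (β x (p - q))
      + inner ℝ (β (y J) (p + q)) (β (x - y J) (p - q)) := by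
    have : ‖β x p‖ ^ 2 - ‖β x q‖ ^ 2 = inner ℝ (β x (p + q)) (β x (p - q)) := by
      simp only [map_add, map_sub, inner_add_left, inner_sub_right, real_inner_self_eq_norm_sq]
      rw [real_inner_comm (β x p) (β x q)]
      ring
    rw [this, map_sub β x, LinearMap.sub_apply, LinearMap.sub_apply, inner_sub_left,
      inner_sub_right]
    ring
  have hκ : 0 ≤ κ := (norm_nonneg _).trans ha
  have e1 : inner ℝ (β (x - y J) (p + q)) (β x (p - q)) ≤ κ * (M + M') :=
    (real_inner_le_norm _ _).trans (mul_le_mul ha (hsub x hx) (norm_nonneg _) hκ)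
  have e2 : inner ℝ (β (y J) (p + q)) (β (x - y J) (p - q)) ≤ (M + M') * κ :=
    (real_inner_le_norm _ _).trans
      (mul_le_mul (hadd _ (hyT J)) hc (norm_nonneg _) ((norm_nonneg _).trans (hadd x hx)))
  rw [e]
  linarith [le_abs_self (inner ℝ (β (y J) (p + q)) (β (y J) (p - q)))]

variable [Fintype G] [DecidableEq G]

/-- Chaining bound for the supremum over `T` of the norms of the Rademacher vectors `β x ε`. -/
theorem card_chaos_sup_gt_le (β : (G → ℝ) →ₗ[ℝ] (G → ℝ) →ₗ[ℝ] E) {T : Set (G → ℝ)}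
    (hT : T.Nonempty) {Q B κ η : ℝ} (hB : 0 < B) (hκ : 0 ≤ κ)
    (hQ : ∀ x ∈ T, ∀ ε, ‖β x (signVec ε)‖ ^ 2 ≤ Q)
    (h2 : ∀ x ∈ T, ∑ ε, ‖β x (signVec ε)‖ ^ 2 ≤ B * Fintype.card (G → Bool))
    {J : ℕ} {N : ℕ → Finset (G → ℝ)} {y : (G → ℝ) → ℕ → G → ℝ}
    (hyN : ∀ x ∈ T, ∀ j, y x j ∈ N j) (hyT : ∀ x ∈ T, ∀ j, y x j ∈ T) (hy : ∀ x ∈ T, y x 0 = 0)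
    {ρ t : ℕ → ℝ} (hρ : ∀ j, 0 ≤ ρ j) (ht : ∀ j, 0 ≤ t j)
    (hop : ∀ x ∈ T, ∀ j u, ‖β (y x (j + 1) - y x j) u‖ ≤ ρ j * √(∑ l, u l ^ 2))
    (hend : ∀ x ∈ T, ∀ u : G → ℝ, (∀ l, |u l| ≤ 2) → ‖β (x - y x J) u‖ ≤ κ)
    (hη : ∑ j ∈ Finset.range J, ((N (j + 1)).card * (N j).card : ℝ)
      * (4 * Real.exp (-(t j ^ 2 / 2))) ≤ η) (hQη : Q * η ≤ B)
    [DecidablePred fun ε : G → Bool => ∃ x ∈ T,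
      6 * ((∑ j ∈ Finset.range J, 2 * t j * ρ j) + κ + √B) < ‖β x (signVec ε)‖] :
    ((Finset.univ.filter fun ε : G → Bool => ∃ x ∈ T,
      6 * ((∑ j ∈ Finset.range J, 2 * t j * ρ j) + κ + √B) < ‖β x (signVec ε)‖).card : ℝ) * B
      ≤ Q * η * Fintype.card (G → Bool) := by
  classical
  set Ev : ℕ → (G → ℝ) × (G → ℝ) → (G → Bool) × (G → Bool) → Prop := fun j z p =>
    (∀ u, ‖β (z.1 - z.2) u‖ ≤ ρ j * √(∑ l, u l ^ 2)) ∧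
    (2 * t j * ρ j * ‖β z.1 (signVec p.1 - signVec p.2)‖
        < |inner ℝ (β (z.1 - z.2) (signVec p.1 + signVec p.2))
          (β z.1 (signVec p.1 - signVec p.2))| ∨
      2 * t j * ρ j * ‖β z.2 (signVec p.1 + signVec p.2)‖
        < |inner ℝ (β (z.1 - z.2) (signVec p.1 - signVec p.2))
          (β z.2 (signVec p.1 + signVec p.2))|) with hEv
  have hEvcard : ∀ j z, ((Finset.univ.filter (Ev j z)).card : ℝ)
      ≤ 4 * Real.exp (-(t j ^ 2 / 2)) * Fintype.card (G → Bool) ^ 2 := by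
    intro j z
    by_cases hz : ∀ u, ‖β (z.1 - z.2) u‖ ≤ ρ j * √(∑ l, u l ^ 2)
    · have := add_le_add (card_inner_add_le (β (z.1 - z.2)) (β z.1) (hρ j) (ht j) hz)
        (card_inner_sub_le (β (z.1 - z.2)) (β z.2) (hρ j) (ht j) hz)
      refine le_trans ?_ (this.trans_eq (by ring))
      norm_cast
      refine le_trans (Finset.card_le_card fun p hp => ?_) (Finset.card_union_le _ _)
      rcases (Finset.mem_filter.mp hp).2.2 with h | h
      · exact Finset.mem_union_left _ (Finset.mem_filter.mpr ⟨Finset.mem_univ _, h⟩)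
      · exact Finset.mem_union_right _ (Finset.mem_filter.mpr ⟨Finset.mem_univ _, h⟩)
    · rw [Finset.filter_false_of_mem fun p _ hp => hz hp.1]
      simp only [Finset.card_empty, Nat.cast_zero]
      positivity
  have hsum0 : 0 ≤ ∑ j ∈ Finset.range J, 2 * t j * ρ j :=
    Finset.sum_nonneg fun j _ => by have := hρ j; have := ht j; positivity
  refine card_sup_gt_le (F := fun x ε => ‖β x (signVec ε)‖) hT (fun _ _ => norm_nonneg _) hB
    (add_nonneg hsum0 hκ) hQ h2
    (Bad := fun p => ∃ j ∈ Finset.range J, ∃ z ∈ N (j + 1) ×ˢ N j, Ev j z p) ?_ ?_ hQη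
  · intro p hp M M' hM hM' x hx
    push Not at hp
    have hgood : ∀ j < J, _ := fun j hj => hp j (Finset.mem_range.mpr hj) (y x (j + 1), y x j)
      (Finset.mem_product.mpr ⟨hyN x hx _, hyN x hx _⟩)
    simp only [hEv, not_and, not_or, not_lt] at hgood
    have hbd : ∀ ε : G → Bool, ∀ l, |signVec ε l| ≤ 1 := fun ε l => (abs_sgn _).le
    exact norm_sq_sub_norm_sq_le β hM hM' (hyT x hx) (hy x hx)
      (fun j => by have := hρ j; have := ht j; positivity)
      (fun j hj => (hgood j hj (hop x hx j)).1) (fun j hj => (hgood j hj (hop x hx j)).2) hx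
      (hend x hx _ fun l => (abs_add_le _ _).trans (by linarith [hbd p.1 l, hbd p.2 l]))
      (hend x hx _ fun l => (abs_sub _ _).trans (by linarith [hbd p.1 l, hbd p.2 l]))
  · calc ((Finset.univ.filter fun p => ∃ j ∈ Finset.range J, ∃ z ∈ N (j + 1) ×ˢ N j,
          Ev j z p).card : ℝ)
        ≤ (((Finset.range J).biUnion fun j => (N (j + 1) ×ˢ N j).biUnion fun z =>
          Finset.univ.filter (Ev j z)).card : ℝ) := by
          norm_cast
          refine Finset.card_le_card fun p hp => ?_
          simpa [and_assoc] using hp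
      _ ≤ ∑ j ∈ Finset.range J, ∑ z ∈ N (j + 1) ×ˢ N j,
          ((Finset.univ.filter (Ev j z)).card : ℝ) := by
          norm_cast
          exact Finset.card_biUnion_le.trans
            (Finset.sum_le_sum fun j _ => Finset.card_biUnion_le)
      _ ≤ ∑ j ∈ Finset.range J, ∑ _z ∈ N (j + 1) ×ˢ N j,
          4 * Real.exp (-(t j ^ 2 / 2)) * (Fintype.card (G → Bool) : ℝ) ^ 2 :=
          Finset.sum_le_sum fun j _ => Finset.sum_le_sum fun z _ => hEvcard j z
      _ = (∑ j ∈ Finset.range J, ((N (j + 1)).card * (N j).card : ℝ)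
          * (4 * Real.exp (-(t j ^ 2 / 2)))) * (Fintype.card (G → Bool) : ℝ) ^ 2 := by
          rw [Finset.sum_mul]
          refine Finset.sum_congr rfl fun j _ => ?_
          rw [Finset.sum_const, Finset.card_product, nsmul_eq_mul]
          push_cast
          ring
      _ ≤ _ := by gcongr

end Chaining

section Nets

variable {G : Type*} [AddCommGroup G] [Fintype G] [DecidableEq G]

/-- The average, scaled by `R`, of the signed coordinate vectors picked by `f`. -/
def signedAverage (R : ℝ) {L : ℕ} (f : Fin L → G × Bool) : G → ℝ :=
  fun j => R / L * ∑ i, if (f i).1 = j then sgn (f i).2 else 0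

omit [AddCommGroup G] in
lemma sum_signedAverage_mul (R : ℝ) {L : ℕ} (f : Fin L → G × Bool) (w : G → ℝ) :
    ∑ j, signedAverage R f j * w j = R / L * ∑ i, sgn (f i).2 * w (f i).1 := by
  simp only [signedAverage, mul_assoc, ← Finset.mul_sum, Finset.sum_mul]
  rw [Finset.sum_comm]
  simp [ite_mul]

/-- Maurey's empirical method for the sup norm of the Fourier transform. -/
lemma exists_signedAverage_near {R : ℝ} (hR : 0 < R) {x : G → ℝ} (hx : ∑ j, |x j| ≤ R) {Λ : ℕ}
    (hΛ : 0 < Λ) (hlog : Real.log (4 * Fintype.card G) ≤ Λ) (n : ℕ) :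
    ∃ f : Fin (2 * 4 ^ n * Λ) → G × Bool, ∀ ψ : AddChar G ℂ,
      ‖∑ j, ((x j - signedAverage R f j : ℝ) : ℂ) * ψ j‖ ≤ 4 * R / 2 ^ n := by
  have hd : (0 : ℝ) < Fintype.card G := by exact_mod_cast Fintype.card_pos
  set S := ∑ j, |x j| with hS
  set L := 2 * 4 ^ n * Λ with hL
  have hL0 : 0 < L := by positivity
  have hΛ0 : (0 : ℝ) < Λ := by exact_mod_cast hΛ
  have hLr : (0 : ℝ) < L := by exact_mod_cast hL0
  set p : G × Bool → ℝ := fun α =>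
    (|x α.1| + sgn α.2 * x α.1) / 2 / R + (1 - S / R) / (2 * Fintype.card G) with hp
  set a : G × Bool → AddChar G ℂ × Bool → ℝ := fun α c =>
    sgn α.2 * (if c.2 then (c.1 α.1).re else (c.1 α.1).im) with ha
  have hsum : ∀ w : G → ℝ, ∑ α, p α * (sgn α.2 * w α.1) = (∑ j, x j * w j) / R := by
    intro w
    rw [Fintype.sum_prod_type, Finset.sum_div]
    refine Finset.sum_congr rfl fun j _ => ?_
    simp only [hp, sgn, Fintype.sum_bool]
    simp
    ring
  have hp0 : ∀ α, 0 ≤ p α := fun α => by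
    have h1 : 0 ≤ 1 - S / R := by
      rw [sub_nonneg, div_le_one hR]; exact hx
    have h2 : 0 ≤ |x α.1| + sgn α.2 * x α.1 := by
      have : |sgn α.2 * x α.1| = |x α.1| := by rw [abs_mul, abs_sgn, one_mul]
      linarith [neg_abs_le (sgn α.2 * x α.1)]
    positivity
  have hp1 : ∑ α, p α = 1 := by
    rw [Fintype.sum_prod_type]
    have : ∀ j, ∑ b, p (j, b) = |x j| / R + (1 - S / R) / Fintype.card G := by
      intro j
      simp only [hp, sgn, Fintype.sum_bool]
      simp
      field_simp
      ring
    rw [Finset.sum_congr rfl fun j _ => this j, Finset.sum_add_distrib, ← Finset.sum_div, ← hS,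
      Finset.sum_const, Finset.card_univ, nsmul_eq_mul]
    field_simp
    ring
  have ha1 : ∀ α c, |a α c| ≤ 1 := fun α c => by
    simp only [ha, abs_mul, abs_sgn, one_mul]
    split_ifs
    · exact (Complex.abs_re_le_norm _).trans (AddChar.norm_apply _ _).le
    · exact (Complex.abs_im_le_norm _).trans (AddChar.norm_apply _ _).le
  have hκ : Real.log (2 * Fintype.card (AddChar G ℂ × Bool)) ≤ Λ := by
    refine le_of_eq_of_le ?_ hlog
    rw [Fintype.card_prod, Fintype.card_bool, AddChar.card_eq]
    push_cast
    ring_nf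
  obtain ⟨f, hf⟩ := exists_empirical hp0 hp1 ha1 hL0 hΛ0 hκ
  refine ⟨f, fun ψ => ?_⟩
  have hsq : √(2 * L * Λ) = 2 * 2 ^ n * Λ := by
    rw [show (2 * L * Λ : ℝ) = (2 * 2 ^ n * Λ) ^ 2 by
      rw [hL]; push_cast; rw [show (4 : ℝ) = 2 ^ 2 by norm_num, ← pow_mul]; ring]
    exact Real.sqrt_sq (by positivity)
  have hbd : ∀ w : G → ℝ,
      |∑ i, sgn (f i).2 * w (f i).1 - L * ((∑ j, x j * w j) / R)| ≤ 2 * √(2 * L * Λ) →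
      |∑ j, (x j - signedAverage R f j) * w j| ≤ 2 * R / 2 ^ n := by
    intro w hw
    have e : ∑ j, (x j - signedAverage R f j) * w j
        = -(R / L) * (∑ i, sgn (f i).2 * w (f i).1 - L * ((∑ j, x j * w j) / R)) := by
      simp only [sub_mul, Finset.sum_sub_distrib, sum_signedAverage_mul]
      field_simp
      ring
    rw [e, abs_mul, abs_neg, abs_of_pos (div_pos hR hLr)]
    refine (mul_le_mul_of_nonneg_left hw (div_pos hR hLr).le).trans_eq ?_
    rw [hsq, hL]
    push_cast
    rw [show (4 : ℝ) = 2 ^ 2 by norm_num, ← pow_mul]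
    field_simp
    ring
  refine (Complex.norm_le_abs_re_add_abs_im _).trans ?_
  rw [Complex.re_sum, Complex.im_sum]
  simp only [Complex.re_ofReal_mul, Complex.im_ofReal_mul]
  have h1 := hbd (fun j => (ψ j).re) (by
    have := hf (ψ, true)
    simp only [ha, if_true] at this
    rwa [hsum fun j => (ψ j).re] at this)
  have h2 := hbd (fun j => (ψ j).im) (by
    have := hf (ψ, false)
    simp only [ha, Bool.false_eq_true, if_false] at this
    rwa [hsum fun j => (ψ j).im] at this)
  calc _ ≤ 2 * R / 2 ^ n + 2 * R / 2 ^ n := add_le_add h1 h2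
    _ = _ := by ring

/-- Entropy bound for subsets of an `ℓ¹` ball in the sup norm of the Fourier transform. -/
lemma exists_charSum_net {T : Set (G → ℝ)} (hT : T.Nonempty) {R : ℝ} (hR : 0 < R)
    (hTR : ∀ x ∈ T, ∑ j, |x j| ≤ R) {Λ : ℕ} (hΛ : 0 < Λ)
    (hlog : Real.log (4 * Fintype.card G) ≤ Λ) (n : ℕ) :
    ∃ N : Finset (G → ℝ), N.card ≤ (2 * Fintype.card G) ^ (2 * 4 ^ n * Λ) ∧ (∀ y ∈ N, y ∈ T) ∧
      ∀ x ∈ T, ∃ y ∈ N, ∀ ψ : AddChar G ℂ,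
        ‖∑ j, ((x j - y j : ℝ) : ℂ) * ψ j‖ ≤ 8 * R / 2 ^ n := by
  classical
  have : ∀ f : Fin (2 * 4 ^ n * Λ) → G × Bool, ∃ y ∈ T, (∃ z ∈ T, ∀ ψ : AddChar G ℂ,
      ‖∑ j, ((z j - signedAverage R f j : ℝ) : ℂ) * ψ j‖ ≤ 4 * R / 2 ^ n) →
      ∀ ψ : AddChar G ℂ, ‖∑ j, ((y j - signedAverage R f j : ℝ) : ℂ) * ψ j‖ ≤ 4 * R / 2 ^ n := by
    intro f
    by_cases h : ∃ z ∈ T, ∀ ψ : AddChar G ℂ,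
      ‖∑ j, ((z j - signedAverage R f j : ℝ) : ℂ) * ψ j‖ ≤ 4 * R / 2 ^ n
    · obtain ⟨z, hz, hzf⟩ := h
      exact ⟨z, hz, fun _ => hzf⟩
    · obtain ⟨z, hz⟩ := hT
      exact ⟨z, hz, fun h' => absurd h' h⟩
  choose y hyT hy using this
  refine ⟨Finset.univ.image y, ?_, ?_, fun x hx => ?_⟩
  · refine Finset.card_image_le.trans_eq ?_
    rw [Finset.card_univ, Fintype.card_fun, Fintype.card_prod, Fintype.card_bool, Fintype.card_fin,
      mul_comm (Fintype.card G)]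
  · simpa using hyT
  · obtain ⟨f, hf⟩ := exists_signedAverage_near hR (hTR x hx) hΛ hlog n
    refine ⟨y f, Finset.mem_image_of_mem _ (Finset.mem_univ _), fun ψ => ?_⟩
    have h1 := hf ψ
    have h2 := hy f ⟨x, hx, hf⟩ ψ
    have e : ∑ j, ((x j - y f j : ℝ) : ℂ) * ψ j
        = ∑ j, ((x j - signedAverage R f j : ℝ) : ℂ) * ψ j
          - ∑ j, ((y f j - signedAverage R f j : ℝ) : ℂ) * ψ j := by
      rw [← Finset.sum_sub_distrib]
      refine Finset.sum_congr rfl fun j _ => ?_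
      push_cast
      ring
    rw [e]
    refine (norm_sub_le _ _).trans ?_
    calc _ ≤ 4 * R / 2 ^ n + 4 * R / 2 ^ n := add_le_add h1 h2
      _ = _ := by ring

omit [DecidableEq G] in
lemma norm_charSum_le (x : G → ℝ) (ψ : AddChar G ℂ) : ‖∑ j, (x j : ℂ) * ψ j‖ ≤ ∑ j, |x j| := by
  refine (norm_sum_le _ _).trans (Finset.sum_le_sum fun j _ => ?_)
  rw [norm_mul, AddChar.norm_apply, mul_one, Complex.norm_real, Real.norm_eq_abs]

/-- Nets at all dyadic scales, the coarsest one being trivial. -/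
lemma exists_charSum_chain {T : Set (G → ℝ)} (hT : 0 ∈ T) {R : ℝ} (hR : 0 < R)
    (hTR : ∀ x ∈ T, ∑ j, |x j| ≤ R) {Λ : ℕ} (hΛ : 0 < Λ)
    (hlog : Real.log (4 * Fintype.card G) ≤ Λ) :
    ∃ (N : ℕ → Finset (G → ℝ)) (y : (G → ℝ) → ℕ → G → ℝ),
      (∀ n, (N n).card ≤ (2 * Fintype.card G) ^ (2 * 4 ^ n * Λ)) ∧
      (∀ x ∈ T, ∀ n, y x n ∈ N n) ∧ (∀ x ∈ T, ∀ n, y x n ∈ T) ∧ (∀ x ∈ T, y x 0 = 0) ∧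
      ∀ x ∈ T, ∀ n, ∀ ψ : AddChar G ℂ,
        ‖∑ j, ((x j - y x n j : ℝ) : ℂ) * ψ j‖ ≤ 8 * R / 2 ^ n := by
  classical
  have : ∀ n, ∃ N : Finset (G → ℝ), (n = 0 → N = {0}) ∧
      N.card ≤ (2 * Fintype.card G) ^ (2 * 4 ^ n * Λ) ∧ (∀ y ∈ N, y ∈ T) ∧
      ∀ x ∈ T, ∃ y ∈ N, ∀ ψ : AddChar G ℂ,
        ‖∑ j, ((x j - y j : ℝ) : ℂ) * ψ j‖ ≤ 8 * R / 2 ^ n := by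
    intro n
    rcases Nat.eq_zero_or_pos n with rfl | hn
    · refine ⟨{0}, fun _ => rfl, ?_, by simpa using hT, fun x hx => ⟨0, by simp, fun ψ => ?_⟩⟩
      · rw [Finset.card_singleton]
        exact Nat.one_le_pow _ _ (by have := Fintype.card_pos (α := G); omega)
      · simp only [Pi.zero_apply, sub_zero, pow_zero, div_one]
        linarith [norm_charSum_le x ψ, hTR x hx]
    · obtain ⟨N, hN⟩ := exists_charSum_net ⟨0, hT⟩ hR hTR hΛ hlog n
      exact ⟨N, fun h => absurd h hn.ne', hN⟩
  choose N hN0 hNc hNT hN using this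
  have : ∀ x n, ∃ y, x ∈ T → y ∈ N n ∧ ∀ ψ : AddChar G ℂ,
      ‖∑ j, ((x j - y j : ℝ) : ℂ) * ψ j‖ ≤ 8 * R / 2 ^ n := by
    intro x n
    by_cases hx : x ∈ T
    · obtain ⟨y, hy⟩ := hN n x hx
      exact ⟨y, fun _ => hy⟩
    · exact ⟨0, fun h => absurd h hx⟩
  choose y hy using this
  refine ⟨N, y, hNc, fun x hx n => (hy x n hx).1, fun x hx n => hNT n _ (hy x n hx).1,
    fun x hx => ?_, fun x hx n => (hy x n hx).2⟩
  have := (hy x 0 hx).1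
  rwa [hN0 0 rfl, Finset.mem_singleton] at this

end Nets

section Sparse

variable {G : Type*} [Fintype G] [DecidableEq G]

lemma sum_sgn_mul_sgn (l l' : G) :
    ∑ ε : G → Bool, sgn (ε l) * sgn (ε l')
      = if l = l' then (Fintype.card (G → Bool) : ℝ) else 0 := by
  split_ifs with h
  · simp [h, ← sq, sgn_sq]
  · set e : (G → Bool) ≃ (G → Bool) :=
      Function.Involutive.toPerm (fun ε => Function.update ε l (!ε l)) fun ε => by simp
    have : ∑ ε : G → Bool, sgn (ε l) * sgn (ε l') = ∑ ε : G → Bool, -(sgn (ε l) * sgn (ε l')) := by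
      refine Fintype.sum_equiv e _ _ fun ε => ?_
      simp [e, Function.Involutive.toPerm, Function.update_of_ne (Ne.symm h), sgn_not]
    rw [Finset.sum_neg_distrib] at this
    linarith

lemma sum_sq_rademacher (c : G → ℝ) :
    ∑ ε : G → Bool, (∑ l, c l * sgn (ε l)) ^ 2 = Fintype.card (G → Bool) * ∑ l, c l ^ 2 := by
  have : ∀ ε : G → Bool, (∑ l, c l * sgn (ε l)) ^ 2
      = ∑ l, ∑ l', c l * c l' * (sgn (ε l) * sgn (ε l')) := fun ε => by
    rw [sq, Finset.sum_mul_sum]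
    exact Finset.sum_congr rfl fun l _ => Finset.sum_congr rfl fun l' _ => by ring
  rw [Finset.sum_congr rfl fun ε _ => this ε, Finset.sum_comm, Finset.mul_sum]
  refine Finset.sum_congr rfl fun l _ => ?_
  rw [Finset.sum_comm]
  simp_rw [← Finset.mul_sum, sum_sgn_mul_sgn]
  simp
  ring

/-- Real `s`-sparse vectors in the unit ball. -/
def sparseBall (G : Type*) [Fintype G] (s : ℕ) : Set (G → ℝ) :=
  {x | (Finset.univ.filter fun j => x j ≠ 0).card ≤ s ∧ ∑ j, x j ^ 2 ≤ 1}

omit [DecidableEq G] in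
lemma sum_abs_le_of_sparse {x : G → ℝ} {s : ℕ}
    (hx : (Finset.univ.filter fun j => x j ≠ 0).card ≤ s) {r : ℝ} (hr : 0 ≤ r)
    (hx2 : ∑ j, x j ^ 2 ≤ r ^ 2) : ∑ j, |x j| ≤ √s * r := by
  have h1 : ∑ j, |x j| = ∑ j ∈ Finset.univ.filter (fun j => x j ≠ 0), |x j| := by
    rw [Finset.sum_filter]
    refine Finset.sum_congr rfl fun j _ => ?_
    split_ifs with h
    · rfl
    · simpa using h
  have h2 := sq_sum_le_card_mul_sum_sq (s := Finset.univ.filter fun j => x j ≠ 0)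
    (f := fun j => |x j|)
  rw [← h1] at h2
  refine abs_le_of_sq_le_sq' ?_ (by positivity) |>.2
  rw [mul_pow, Real.sq_sqrt (by positivity)]
  refine h2.trans (mul_le_mul (by exact_mod_cast hx) ?_ (by positivity) (by positivity))
  refine le_trans ?_ hx2
  simp only [sq_abs]
  exact Finset.sum_le_univ_sum_of_nonneg fun j => sq_nonneg _

variable [AddCommGroup G]

/-- The rows indexed by `ω` of the convolution of `x` and `u`. -/
def rowConv {B : ℕ} (ω : Fin B → G) : (G → ℝ) →ₗ[ℝ] (G → ℝ) →ₗ[ℝ] EuclideanSpace ℝ (Fin B) :=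
  LinearMap.mk₂ ℝ (fun x u => WithLp.toLp 2 fun i => ∑ j, x j * u (ω i - j))
    (fun x x' u => by ext i; simp [add_mul, Finset.sum_add_distrib])
    (fun c x u => by ext i; simp [Finset.mul_sum, mul_assoc])
    (fun x u u' => by ext i; simp [mul_add, Finset.sum_add_distrib])
    (fun c x u => by ext i; simp [Finset.mul_sum, mul_left_comm])

omit [DecidableEq G] in
lemma norm_sq_rowConv {B : ℕ} (ω : Fin B → G) (x u : G → ℝ) :
    ‖rowConv ω x u‖ ^ 2 = ∑ i, (∑ j, x j * u (ω i - j)) ^ 2 := by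
  rw [EuclideanSpace.real_norm_sq_eq]
  rfl

omit [DecidableEq G] in
lemma norm_rowConv_le_of_charSum {B : ℕ} {ω : Fin B → G} (hω : Function.Injective ω) (x u : G → ℝ)
    {r : ℝ} (hr : 0 ≤ r) (h : ∀ ψ : AddChar G ℂ, ‖∑ j, (x j : ℂ) * ψ j‖ ≤ r) :
    ‖rowConv ω x u‖ ≤ r * √(∑ l, u l ^ 2) := by
  classical
  refine abs_le_of_sq_le_sq' ?_ (by positivity) |>.2
  rw [norm_sq_rowConv, mul_pow, Real.sq_sqrt (Finset.sum_nonneg fun l _ => sq_nonneg _)]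
  refine le_trans ?_ (sum_sq_conv_le x u h)
  rw [← Finset.sum_image (s := Finset.univ) (g := ω) (f := fun i => (∑ j, x j * u (i - j)) ^ 2)
    fun a _ b _ h => hω h]
  exact Finset.sum_le_univ_sum_of_nonneg fun j => sq_nonneg _

omit [DecidableEq G] in
lemma norm_rowConv_le {B : ℕ} (ω : Fin B → G) (x u : G → ℝ) {M : ℝ} (hM : 0 ≤ M)
    (hu : ∀ l, |u l| ≤ M) : ‖rowConv ω x u‖ ≤ √B * ((∑ j, |x j|) * M) := by
  have hS : 0 ≤ ∑ j, |x j| := Finset.sum_nonneg fun j _ => abs_nonneg _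
  refine abs_le_of_sq_le_sq' ?_ (by positivity) |>.2
  rw [norm_sq_rowConv, mul_pow, Real.sq_sqrt (by positivity)]
  calc _ ≤ ∑ _i : Fin B, ((∑ j, |x j|) * M) ^ 2 := by
        refine Finset.sum_le_sum fun i _ => ?_
        rw [← sq_abs (∑ j, x j * u (ω i - j))]
        refine pow_le_pow_left₀ (abs_nonneg _) ?_ 2
        refine (Finset.abs_sum_le_sum_abs _ _).trans ?_
        rw [Finset.sum_mul]
        refine Finset.sum_le_sum fun j _ => ?_
        rw [abs_mul]
        exact mul_le_mul_of_nonneg_left (hu _) (abs_nonneg _)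
    _ = _ := by simp

lemma sum_norm_sq_rowConv {B : ℕ} (ω : Fin B → G) (x : G → ℝ) :
    ∑ ε : G → Bool, ‖rowConv ω x (signVec ε)‖ ^ 2
      = B * (∑ j, x j ^ 2) * Fintype.card (G → Bool) := by
  have h : ∀ ε : G → Bool, ∀ i, ∑ j, x j * signVec ε (ω i - j)
      = ∑ l, x (ω i - l) * sgn (ε l) := fun ε i =>
    Fintype.sum_equiv (Equiv.subLeft (ω i)) _ _ fun j => by simp [signVec]
  have h' : ∀ i, ∑ l, x (ω i - l) ^ 2 = ∑ j, x j ^ 2 := fun i =>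
    Fintype.sum_equiv (Equiv.subLeft (ω i)) _ _ fun j => by simp
  simp_rw [norm_sq_rowConv, h]
  rw [Finset.sum_comm]
  simp_rw [sum_sq_rademacher, h']
  simp
  ring

end Sparse

section CirculantChaos

variable {G : Type*} [Fintype G] [DecidableEq G] [AddCommGroup G]

omit [DecidableEq G] [AddCommGroup G] in
lemma zero_mem_sparseBall (s : ℕ) : (0 : G → ℝ) ∈ sparseBall G s := by
  simp [sparseBall]

omit [DecidableEq G] in
lemma sum_abs_sub_le_of_sparse {x y : G → ℝ} {s : ℕ} (hx : x ∈ sparseBall G s)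
    (hy : y ∈ sparseBall G s) {r : ℝ} (hr : 0 ≤ r)
    (h : ∀ ψ : AddChar G ℂ, ‖∑ j, ((x j - y j : ℝ) : ℂ) * ψ j‖ ≤ r) :
    ∑ j, |(x - y) j| ≤ √((2 * s : ℕ) : ℝ) * r := by
  classical
  refine sum_abs_le_of_sparse (le_trans (Finset.card_le_card fun j hj => ?_)
    ((Finset.card_union_le _ _).trans (add_le_add hx.1 hy.1) |>.trans_eq (two_mul s).symm)) hr
    (sum_sq_le_of_charSum_le _ h)
  simp only [Finset.mem_union, Finset.mem_filter, Finset.mem_univ, true_and] at hj ⊢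
  by_contra! hcon
  simp [hcon] at hj

lemma two_mul_pow_mul_exp_le {d n : ℕ} (hd : 2 ≤ d) {Λ : ℕ} (hΛ : 0 < Λ)
    (hΛd : (Λ : ℝ) ≤ 5 * Real.log d) :
    (((2 * d) ^ (2 * 4 ^ (n + 1) * Λ) * (2 * d) ^ (2 * 4 ^ n * Λ) : ℕ) : ℝ)
      * (4 * Real.exp (-((2 ^ n * (20 * Real.log d)) ^ 2 / 2))) ≤ 4 / (2 * d) ^ 8 := by
  have hd' : (2 : ℝ) ≤ d := by exact_mod_cast hd
  have hlog0 : 0 ≤ Real.log d := Real.log_nonneg (by linarith)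
  have hlog2 : 0 ≤ Real.log (2 * d) := Real.log_nonneg (by linarith)
  have hlog : Real.log (2 * d) ≤ 2 * Real.log d := by
    rw [Real.log_mul (by norm_num) (by linarith)]
    linarith [Real.log_le_log (by norm_num) hd']
  have hΛ1 : (1 : ℝ) ≤ Λ := by exact_mod_cast hΛ
  have hexp : (2 * d : ℝ) = Real.exp (Real.log (2 * d)) := (Real.exp_log (by linarith)).symm
  have h4 : (1 : ℝ) ≤ 4 ^ n := one_le_pow₀ (by norm_num)
  rw [div_eq_mul_inv, mul_left_comm]
  refine mul_le_mul_of_nonneg_left ?_ (by norm_num)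
  push_cast
  rw [← pow_add, hexp, ← Real.exp_nat_mul, ← Real.exp_nat_mul, ← Real.exp_neg, ← Real.exp_add,
    Real.exp_le_exp]
  push_cast
  rw [mul_pow, ← pow_mul, mul_comm n 2, pow_mul, pow_succ]
  norm_num
  have h1 : (Λ : ℝ) * Real.log (2 * d) ≤ 5 * Real.log d * (2 * Real.log d) :=
    mul_le_mul hΛd hlog hlog2 (by positivity)
  have h2 := mul_le_mul_of_nonneg_left h1 (zero_le_one.trans h4)
  have h3 : Real.log (2 * d) ≤ 4 ^ n * (Λ * Real.log (2 * d)) := by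
    exact (le_mul_of_one_le_left hlog2 hΛ1).trans (le_mul_of_one_le_left (by positivity) h4)
  nlinarith [mul_nonneg (zero_le_one.trans h4) (sq_nonneg (Real.log d))]

/-- Tail bound for the suprema of the bucket norms over real sparse vectors. -/
theorem card_rowConv_sup_gt_le {B : ℕ} (hB : 0 < B) {ω : Fin B → G} (hω : Function.Injective ω)
    {d : ℕ} (hdG : Fintype.card G = d) (hd : 2 ≤ d) {s J : ℕ} (hs : 0 < s) (hsJ : s ≤ 2 ^ J)
    (hJ : J ≤ d)
    [DecidablePred fun ε : G → Bool => ∃ x ∈ sparseBall G s,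
      2880 * (√B + J * √s * Real.log d) < ‖rowConv ω x (signVec ε)‖] :
    ((Finset.univ.filter fun ε : G → Bool => ∃ x ∈ sparseBall G s,
      2880 * (√B + J * √s * Real.log d) < ‖rowConv ω x (signVec ε)‖).card : ℝ)
      * (64 * d ^ 6) ≤ Fintype.card (G → Bool) := by
  classical
  have hd' : (2 : ℝ) ≤ d := by exact_mod_cast hd
  have hd0 : (0 : ℝ) < d := by linarith
  have hBr : (0 : ℝ) < B := by exact_mod_cast hB
  have hsr : (0 : ℝ) < √s := Real.sqrt_pos.mpr (by exact_mod_cast hs)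
  have hlog2 : 0.69 ≤ Real.log 2 := by linarith [Real.log_two_gt_d9]
  have hlogd : Real.log 2 ≤ Real.log d := Real.log_le_log (by norm_num) hd'
  set Λ := ⌈Real.log (4 * d)⌉₊ with hΛ_def
  have hlog4 : Real.log (4 * d) = 2 * Real.log 2 + Real.log d := by
    rw [Real.log_mul (by norm_num) hd0.ne', show (4 : ℝ) = 2 ^ 2 by norm_num, Real.log_pow]
    norm_num
  have hlog4pos : 0 < Real.log (4 * d) := by rw [hlog4]; linarith
  have hΛ : 0 < Λ := Nat.ceil_pos.mpr hlog4pos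
  have hΛd : (Λ : ℝ) ≤ 5 * Real.log d := by
    have := Nat.ceil_lt_add_one hlog4pos.le
    rw [← hΛ_def] at this
    linarith
  have hTR : ∀ x ∈ sparseBall G s, ∑ j, |x j| ≤ √s := fun x hx => by
    simpa using sum_abs_le_of_sparse hx.1 zero_le_one (by simpa using hx.2)
  obtain ⟨N, y, hNc, hyN, hyT, hy0, hy⟩ :=
    exists_charSum_chain (zero_mem_sparseBall s) hsr hTR hΛ
      (by rw [hdG]; exact Nat.le_ceil _)
  rw [hdG] at hNc
  set ρ : ℕ → ℝ := fun j => 12 * √s / 2 ^ j with hρ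
  set t : ℕ → ℝ := fun j => 2 ^ j * (20 * Real.log d) with ht
  have hJr : (J : ℝ) ≤ d := by exact_mod_cast hJ
  set η : ℝ := J * (4 / (2 * d) ^ 8) with hη
  have hsum : ∑ j ∈ Finset.range J, 2 * t j * ρ j = 480 * (J * √s * Real.log d) := by
    have : ∀ j, 2 * t j * ρ j = 480 * (√s * Real.log d) := fun j => by
      simp only [ht, hρ]; field_simp; ring
    simp_rw [this]
    rw [Finset.sum_const, Finset.card_range, nsmul_eq_mul]
    ring
  have hη1 : d * η * (64 * d ^ 6) ≤ 1 := by
    have e : d * η * (64 * d ^ 6) = J / d := by rw [hη]; field_simp; ring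
    rw [e, div_le_one hd0]
    exact hJr
  have hη0 : 0 ≤ η := by positivity
  have hd6 : (1 : ℝ) ≤ d ^ 6 := one_le_pow₀ (by linarith)
  have main := card_chaos_sup_gt_le (rowConv ω) (T := sparseBall G s) ⟨0, zero_mem_sparseBall s⟩
    (Q := B * d) (B := B) (κ := 23 * √B) (η := η) hBr (by positivity) (fun x hx ε => ?_)
    (fun x hx => ?_) (J := J) hyN hyT hy0 (ρ := ρ) (t := t) (fun j => by positivity)
    (fun j => by have : 0 ≤ Real.log d := by linarith
                 positivity) (fun x hx j u => ?_) (fun x hx u hu => ?_) ?_ ?_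
  · rw [hsum] at main
    have hcard : ((Finset.univ.filter fun ε : G → Bool => ∃ x ∈ sparseBall G s,
        2880 * (√B + J * √s * Real.log d) < ‖rowConv ω x (signVec ε)‖).card : ℝ)
        ≤ ((Finset.univ.filter fun ε : G → Bool => ∃ x ∈ sparseBall G s,
        6 * (480 * (J * √s * Real.log d) + 23 * √B + √B) < ‖rowConv ω x (signVec ε)‖).card : ℝ) := by
      norm_cast
      refine Finset.card_le_card fun ε hε => ?_
      obtain ⟨x, hx, hlt⟩ := (Finset.mem_filter.mp hε).2
      refine Finset.mem_filter.mpr ⟨Finset.mem_univ _, x, hx, lt_of_le_of_lt ?_ hlt⟩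
      nlinarith [Real.sqrt_nonneg (B : ℝ)]
    refine le_of_mul_le_mul_right ?_ hBr
    refine (mul_le_mul_of_nonneg_right
      (mul_le_mul_of_nonneg_right hcard (by positivity)) hBr.le).trans ?_
    rw [mul_right_comm]
    refine (mul_le_mul_of_nonneg_right main (by positivity)).trans ?_
    calc (B : ℝ) * d * η * Fintype.card (G → Bool) * (64 * (d : ℝ) ^ 6)
        = (B : ℝ) * (d * η * (64 * d ^ 6)) * Fintype.card (G → Bool) := by ring
      _ ≤ (B : ℝ) * 1 * Fintype.card (G → Bool) := by gcongr
      _ = _ := by ring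
  · have h1 := norm_rowConv_le ω x (signVec ε) zero_le_one fun l => (abs_sgn _).le
    have h2 : ∑ j, |x j| ≤ √(d : ℝ) * 1 :=
      sum_abs_le_of_sparse ((Finset.card_le_univ _).trans_eq hdG) zero_le_one (by simpa using hx.2)
    calc _ ≤ (√B * (√(d : ℝ) * 1 * 1)) ^ 2 := by
          refine pow_le_pow_left₀ (norm_nonneg _) (h1.trans ?_) 2
          gcongr
      _ = _ := by
          rw [mul_one, mul_one, mul_pow, Real.sq_sqrt hBr.le, Real.sq_sqrt hd0.le]
  · rw [sum_norm_sq_rowConv]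
    have := hx.2
    calc _ ≤ B * 1 * (Fintype.card (G → Bool) : ℝ) := by gcongr
      _ = _ := by ring
  · refine norm_rowConv_le_of_charSum hω _ _ (by positivity) fun ψ => ?_
    have h1 := hy x hx j ψ
    have h2 := hy x hx (j + 1) ψ
    have e : ∑ l, (((y x (j + 1) - y x j) l : ℝ) : ℂ) * ψ l
        = ∑ l, ((x l - y x j l : ℝ) : ℂ) * ψ l - ∑ l, ((x l - y x (j + 1) l : ℝ) : ℂ) * ψ l := by
      rw [← Finset.sum_sub_distrib]
      refine Finset.sum_congr rfl fun l _ => ?_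
      rw [Pi.sub_apply]
      push_cast
      ring
    rw [e]
    refine (norm_sub_le _ _).trans ((add_le_add h1 h2).trans_eq ?_)
    simp only [hρ]
    rw [pow_succ]
    field_simp
    norm_num
  · have h1 := norm_rowConv_le ω (x - y x J) u zero_le_two hu
    have h2 := sum_abs_sub_le_of_sparse hx (hyT x hx J) (by positivity) (hy x hx J)
    have h3 : √((2 * s : ℕ) : ℝ) * (8 * √s / 2 ^ J) ≤ 8 * √2 := by
      push_cast
      rw [Real.sqrt_mul (by norm_num)]
      have : √(s : ℝ) * √s ≤ 2 ^ J := by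
        rw [Real.mul_self_sqrt (Nat.cast_nonneg _)]; exact_mod_cast hsJ
      calc _ = 8 * √2 * ((√(s : ℝ) * √s) / 2 ^ J) := by ring
        _ ≤ 8 * √2 * 1 := by
          gcongr
          rwa [div_le_one (by positivity)]
        _ = _ := mul_one _
    have h4 : √2 ≤ 1.42 := by
      rw [Real.sqrt_le_left (by norm_num)]; norm_num
    calc _ ≤ √B * (8 * 1.42 * 2) := by
          refine h1.trans ?_
          gcongr
          linarith
      _ ≤ _ := by nlinarith [Real.sqrt_nonneg (B : ℝ)]
  · calc _ ≤ ∑ _j ∈ Finset.range J, 4 / (2 * d : ℝ) ^ 8 := by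
          refine Finset.sum_le_sum fun j _ => le_trans ?_ (two_mul_pow_mul_exp_le (n := j) hd hΛ hΛd)
          push_cast
          gcongr
          · exact_mod_cast hNc (j + 1)
          · exact_mod_cast hNc j
      _ = _ := by rw [Finset.sum_const, Finset.card_range, nsmul_eq_mul]
  · rw [mul_assoc]
    refine mul_le_of_le_one_right hBr.le ?_
    nlinarith [mul_nonneg hd0.le hη0]

end CirculantChaos

section Bucket

lemma uniform_toMeasure_ge {α : Type*} [Fintype α] [Nonempty α] [MeasurableSpace α]
    [MeasurableSingletonClass α] (P : α → Prop) [DecidablePred P]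
    (h : 8 * (Finset.univ.filter fun a => ¬ P a).card ≤ Fintype.card α) :
    (PMF.uniformOfFintype α).toMeasure {a | P a} ≥ 7 / 8 := by
  have hc := Finset.card_filter_add_card_filter_not (s := (Finset.univ : Finset α)) P
  rw [Finset.card_univ] at hc
  rw [PMF.toMeasure_uniformOfFintype_apply _ (Set.toFinite _).measurableSet, ge_iff_le,
    ENNReal.le_div_iff_mul_le (by simp) (by simp), ← ENNReal.mul_div_right_comm,
    ENNReal.div_le_iff (by simp) (by simp)]
  have : Fintype.card {a | P a} = (Finset.univ.filter P).card := Fintype.card_subtype P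
  rw [this]
  norm_cast
  omega

variable {m B d : ℕ} [NeZero d]

lemma sq_l2norm_bucket (Ω : Fin (m * B) ↪ Fin d) (ε : Fin d → Bool) (b : Fin m)
    (x : Fin d → ℂ) :
    l2norm (mvec (bucket m B d (pcMatrix (m * B) d Ω ε) b) x) ^ 2
      = ‖rowConv (fun i => Ω (hIdx m B b i)) (fun j => (x j).re) (signVec ε)‖ ^ 2
        + ‖rowConv (fun i => Ω (hIdx m B b i)) (fun j => (x j).im) (signVec ε)‖ ^ 2 := by
  rw [l2norm, Real.sq_sqrt (Finset.sum_nonneg fun i _ => sq_nonneg _), norm_sq_rowConv,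
    norm_sq_rowConv, ← Finset.sum_add_distrib]
  refine Finset.sum_congr rfl fun i _ => ?_
  rw [Complex.sq_norm, Complex.normSq_apply, ← sq, ← sq]
  simp only [mvec, bucket, pcMatrix, signVec, Complex.re_sum, Complex.im_sum,
    Complex.re_ofReal_mul, Complex.im_ofReal_mul]
  simp only [mul_comm]

lemma hIdx_injective (b : Fin m) : Function.Injective (hIdx m B b) := fun i j h => by
  have := congrArg Fin.val h
  simp only [hIdx] at this
  exact Fin.ext (by omega)

lemma re_im_mem_sparseBall {d s : ℕ} {x : Fin d → ℂ} (hx : x ∈ Tset d s) :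
    (fun j => (x j).re) ∈ sparseBall (Fin d) s ∧ (fun j => (x j).im) ∈ sparseBall (Fin d) s := by
  have h1 : ∑ j, ‖x j‖ ^ 2 ≤ 1 := by
    have := hx.2
    rwa [l2norm, Real.sqrt_le_left zero_le_one, one_pow] at this
  refine ⟨⟨(Finset.card_le_card fun j hj => ?_).trans hx.1, (Finset.sum_le_sum fun j _ => ?_).trans h1⟩,
    ⟨(Finset.card_le_card fun j hj => ?_).trans hx.1, (Finset.sum_le_sum fun j _ => ?_).trans h1⟩⟩
  · simp only [Finset.mem_filter, Finset.mem_univ, true_and] at hj ⊢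
    exact fun h => hj (by simp [h])
  · rw [Complex.sq_norm, Complex.normSq_apply]; nlinarith [sq_nonneg (x j).im]
  · simp only [Finset.mem_filter, Finset.mem_univ, true_and] at hj ⊢
    exact fun h => hj (by simp [h])
  · rw [Complex.sq_norm, Complex.normSq_apply]; nlinarith [sq_nonneg (x j).re]

lemma l2norm_bucket_le_of_real (Ω : Fin (m * B) ↪ Fin d) (ε : Fin d → Bool) (b : Fin m)
    {s : ℕ} {M : ℝ} (hM : ∀ u ∈ sparseBall (Fin d) s,
      ‖rowConv (fun i => Ω (hIdx m B b i)) u (signVec ε)‖ ≤ M)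
    {x : Fin d → ℂ} (hx : x ∈ Tset d s) :
    l2norm (mvec (bucket m B d (pcMatrix (m * B) d Ω ε) b) x) ≤ 2 * M := by
  have h1 := hM _ (re_im_mem_sparseBall hx).1
  have h2 := hM _ (re_im_mem_sparseBall hx).2
  have h0 := (norm_nonneg _).trans h1
  refine abs_le_of_sq_le_sq' ?_ (by positivity) |>.2
  rw [sq_l2norm_bucket]
  nlinarith [pow_le_pow_left₀ (norm_nonneg _) h1 2, pow_le_pow_left₀ (norm_nonneg _) h2 2]

lemma l2norm_bucket_le_sqrt_mul_sqrt (Ω : Fin (m * B) ↪ Fin d) (ε : Fin d → Bool)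
    (b : Fin m) {s : ℕ} {x : Fin d → ℂ} (hx : x ∈ Tset d s) :
    l2norm (mvec (bucket m B d (pcMatrix (m * B) d Ω ε) b) x) ≤ 2 * (√B * √s) := by
  refine l2norm_bucket_le_of_real Ω ε b (fun u hu => ?_) hx
  refine (norm_rowConv_le _ u (signVec ε) zero_le_one fun l => (abs_sgn _).le).trans ?_
  rw [mul_one]
  gcongr
  simpa using sum_abs_le_of_sparse hu.1 zero_le_one (by simpa using hu.2)

lemma Tset_min {d s : ℕ} {x : Fin d → ℂ} (hx : x ∈ Tset d s) : x ∈ Tset d (min s d) :=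
  ⟨le_min hx.1 ((Finset.card_le_univ _).trans_eq (Fintype.card_fin d)), hx.2⟩

lemma log_two_add_one_le {s k : ℕ} (hk : 2 ≤ k) (hs : 0 < s) (hsk : s ≤ 2 * k) :
    ((Nat.log 2 s + 1 : ℕ) : ℝ) ≤ 5 * Real.log k := by
  have hk' : (2 : ℝ) ≤ k := by exact_mod_cast hk
  have h1 : (2 : ℝ) ^ Nat.log 2 s ≤ 2 * k := by
    exact_mod_cast (Nat.pow_log_le_self 2 hs.ne').trans hsk
  have h2 := Real.log_le_log (by positivity) h1
  rw [Real.log_pow, Real.log_mul (by norm_num) (by linarith)] at h2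
  have h3 := Real.log_le_log (by norm_num) hk'
  have h4 : 0.69 ≤ Real.log 2 := by linarith [Real.log_two_gt_d9]
  have h5 : (0 : ℝ) ≤ (Nat.log 2 s : ℝ) := Nat.cast_nonneg _
  push_cast
  nlinarith

/-- Union bound over the sparsity levels and the buckets. -/
lemma card_bucket_gt_le {k : ℕ} (hB : 0 < B) (hd2 : 2 ≤ d) (hk : 2 ≤ k) (Ω : Fin (m * B) ↪ Fin d)
    [DecidablePred fun ε : Fin d → Bool => ¬ ∀ s : ℕ, 1 ≤ s → s ≤ 2 * k →
      ∀ b : Fin m, ∀ x ∈ Tset d s, l2norm (mvec (bucket m B d (pcMatrix (m * B) d Ω ε) b) x)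
        ≤ 30000 * (√B + √s * Real.log k * Real.log d)] :
    8 * (Finset.univ.filter fun ε : Fin d → Bool => ¬ ∀ s : ℕ, 1 ≤ s → s ≤ 2 * k →
      ∀ b : Fin m, ∀ x ∈ Tset d s, l2norm (mvec (bucket m B d (pcMatrix (m * B) d Ω ε) b) x)
        ≤ 30000 * (√B + √s * Real.log k * Real.log d)).card
      ≤ Fintype.card (Fin d → Bool) := by
  classical
  have hlogd : 0 ≤ Real.log d := Real.log_natCast_nonneg d
  have hlogk : 0 ≤ Real.log k := Real.log_natCast_nonneg k
  have hterm : ∀ s : ℕ, 0 ≤ √s * Real.log k * Real.log d := fun s => by positivity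
  have hmd : m ≤ d := by
    have := Fintype.card_le_of_embedding Ω
    rw [Fintype.card_fin, Fintype.card_fin] at this
    exact (Nat.le_mul_of_pos_right m hB).trans this
  set Bad : ℕ → Fin m → (Fin d → Bool) → Prop := fun s b ε => ∃ u ∈ sparseBall (Fin d) s,
    2880 * (√B + (Nat.log 2 s + 1 : ℕ) * √s * Real.log d)
      < ‖rowConv (fun i => Ω (hIdx m B b i)) u (signVec ε)‖ with hBad
  have hsub : (Finset.univ.filter fun ε : Fin d → Bool => ¬ ∀ s : ℕ, 1 ≤ s → s ≤ 2 * k →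
      ∀ b : Fin m, ∀ x ∈ Tset d s, l2norm (mvec (bucket m B d (pcMatrix (m * B) d Ω ε) b) x)
        ≤ 30000 * (√B + √s * Real.log k * Real.log d))
      ⊆ (Finset.Icc 1 d).biUnion fun s => Finset.univ.biUnion fun b =>
        Finset.univ.filter (Bad s b) := by
    intro ε hε
    by_contra hcon
    refine (Finset.mem_filter.mp hε).2 fun s hs1 hsk b x hx => ?_
    have hs' : min s d ∈ Finset.Icc 1 d := Finset.mem_Icc.mpr (by omega)
    have hgood : ¬ Bad (min s d) b ε := fun hbad => hcon <|
      Finset.mem_biUnion.mpr ⟨_, hs', Finset.mem_biUnion.mpr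
        ⟨b, Finset.mem_univ _, Finset.mem_filter.mpr ⟨Finset.mem_univ _, hbad⟩⟩⟩
    simp only [hBad, not_exists, not_and, not_lt] at hgood
    refine (l2norm_bucket_le_of_real Ω ε b hgood (Tset_min hx)).trans ?_
    have h1 := log_two_add_one_le hk (s := min s d) (by omega) (by omega)
    have h2 : √((min s d : ℕ) : ℝ) ≤ √s := Real.sqrt_le_sqrt (by exact_mod_cast min_le_left s d)
    have h3 : ((Nat.log 2 (min s d) + 1 : ℕ) : ℝ) * √((min s d : ℕ) : ℝ) * Real.log d
        ≤ 5 * Real.log k * √s * Real.log d := by gcongr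
    nlinarith [hterm s, Real.sqrt_nonneg (B : ℝ)]
  have hcard : ∀ s ∈ Finset.Icc 1 d, ∀ b : Fin m,
      ((Finset.univ.filter (Bad s b)).card : ℝ) * (64 * d ^ 6) ≤ Fintype.card (Fin d → Bool) := by
    intro s hs b
    rw [Finset.mem_Icc] at hs
    exact card_rowConv_sup_gt_le hB (Ω.injective.comp (hIdx_injective b)) (Fintype.card_fin d) hd2
      hs.1 (Nat.lt_pow_succ_log_self one_lt_two s).le
      ((Nat.log_lt_self 2 (by omega)).trans_le hs.2)
  have hcard' : ∀ s ∈ Finset.Icc 1 d, ∀ b : Fin m,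
      (Finset.univ.filter (Bad s b)).card * (64 * d ^ 6) ≤ Fintype.card (Fin d → Bool) :=
    fun s hs b => by exact_mod_cast hcard s hs b
  have htot : ((Finset.Icc 1 d).biUnion fun s => Finset.univ.biUnion fun b =>
      Finset.univ.filter (Bad s b)).card * (64 * d ^ 6) ≤ d * (m * Fintype.card (Fin d → Bool)) := by
    calc _ ≤ (∑ s ∈ Finset.Icc 1 d, ∑ b : Fin m, (Finset.univ.filter (Bad s b)).card)
          * (64 * d ^ 6) := Nat.mul_le_mul_right _ (Finset.card_biUnion_le.trans
            (Finset.sum_le_sum fun s _ => Finset.card_biUnion_le))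
      _ ≤ ∑ _s ∈ Finset.Icc 1 d, ∑ _b : Fin m, Fintype.card (Fin d → Bool) := by
          simp_rw [Finset.sum_mul]
          exact Finset.sum_le_sum fun s hs => Finset.sum_le_sum fun b _ => hcard' s hs b
      _ = _ := by simp
  refine le_trans (Nat.mul_le_mul_left 8 (Finset.card_le_card hsub)) ?_
  refine Nat.le_of_mul_le_mul_left ?_ (show 0 < d ^ 6 by positivity)
  have hd6 : d * (m * Fintype.card (Fin d → Bool)) ≤ d ^ 6 * Fintype.card (Fin d → Bool) := by
    calc _ ≤ d * (d * Fintype.card (Fin d → Bool)) := by gcongr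
      _ = d ^ 2 * Fintype.card (Fin d → Bool) := by ring
      _ ≤ _ := by gcongr <;> omega
  refine le_trans ?_ (htot.trans hd6)
  calc _ = (Finset.card _ * d ^ 6) * 8 := by ring
    _ ≤ (Finset.card _ * d ^ 6) * 64 := Nat.mul_le_mul_left _ (by norm_num)
    _ = _ := by ring

end Bucket

/-- Lemma `circ-conc`, implicit in KMR12: for the partial circulant ensemble,
with probability ≥ 7/8 over the random signs, for every `s ∈ [2k]` and every bucket `b`,
`sup_{x∈T_s}‖A_b x‖₂ ≤ C(√B + √s·log k·log d)`. -/
theorem stmt8 :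
    ∃ C : ℝ, 0 < C ∧
      ∀ (m B d k : ℕ) (Ω : Fin (m * B) ↪ Fin d),
        (PMF.uniformOfFintype (Fin d → Bool)).toMeasure
            {ε | ∀ s : ℕ, 1 ≤ s → s ≤ 2 * k → ∀ b : Fin m, ∀ x ∈ Tset d s,
              l2norm (mvec (bucket m B d (pcMatrix (m * B) d Ω ε) b) x)
                ≤ C * (Real.sqrt B + Real.sqrt s * Real.log k * Real.log d)}
          ≥ 7 / 8 := by
  classical
  refine ⟨30000, by norm_num, fun m B d k Ω => ?_⟩
  have hlogd : 0 ≤ Real.log d := Real.log_natCast_nonneg d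
  have hlogk : 0 ≤ Real.log k := Real.log_natCast_nonneg k
  have hterm : ∀ s : ℕ, 0 ≤ √s * Real.log k * Real.log d := fun s => by positivity
  refine uniform_toMeasure_ge _ ?_
  have hdet : (∀ ε : Fin d → Bool, ∀ s : ℕ, 1 ≤ s → s ≤ 2 * k → ∀ b : Fin m, ∀ x ∈ Tset d s,
      l2norm (mvec (bucket m B d (pcMatrix (m * B) d Ω ε) b) x)
        ≤ 30000 * (Real.sqrt B + Real.sqrt s * Real.log k * Real.log d)) →
      8 * (Finset.univ.filter fun ε : Fin d → Bool => ¬ ∀ s : ℕ, 1 ≤ s → s ≤ 2 * k → ∀ b : Fin m,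
        ∀ x ∈ Tset d s, l2norm (mvec (bucket m B d (pcMatrix (m * B) d Ω ε) b) x)
        ≤ 30000 * (Real.sqrt B + Real.sqrt s * Real.log k * Real.log d)).card
      ≤ Fintype.card (Fin d → Bool) := fun h => by
    rw [Finset.filter_false_of_mem fun ε _ => not_not.mpr (h ε)]
    simp
  rcases Nat.eq_zero_or_pos B with rfl | hB
  · refine hdet fun ε s _ _ b x _ => ?_
    have := hterm s
    simp only [l2norm, Finset.univ_eq_empty, Finset.sum_empty, Real.sqrt_zero]
    positivity
  obtain _ | n := d
  · exact hdet fun ε s _ _ b x _ => (Ω (hIdx m B b ⟨0, hB⟩)).elim0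
  have hsmall : ∀ s : ℕ, ∀ ε : Fin (n + 1) → Bool, ∀ b : Fin m, ∀ x ∈ Tset (n + 1) s,
      min s (n + 1) ≤ 2 → l2norm (mvec (bucket m B (n + 1) (pcMatrix (m * B) (n + 1) Ω ε) b) x)
        ≤ 30000 * (Real.sqrt B + Real.sqrt s * Real.log k * Real.log ((n + 1 : ℕ) : ℝ)) := by
    intro s ε b x hx hs
    have h1 := l2norm_bucket_le_sqrt_mul_sqrt Ω ε b (Tset_min hx)
    have h2 : √((min s (n + 1) : ℕ) : ℝ) ≤ 2 := by
      rw [Real.sqrt_le_left (by norm_num)]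
      have : ((min s (n + 1) : ℕ) : ℝ) ≤ 2 := by exact_mod_cast hs
      linarith
    nlinarith [hterm s, Real.sqrt_nonneg (B : ℝ),
      mul_le_mul_of_nonneg_left h2 (Real.sqrt_nonneg (B : ℝ))]
  rcases lt_or_ge k 2 with hk | hk
  · exact hdet fun ε s _ hs b x hx => hsmall s ε b x hx (by omega)
  rcases Nat.eq_zero_or_pos n with rfl | hn
  · exact hdet fun ε s _ hs b x hx => hsmall s ε b x hx (by omega)
  exact card_bucket_gt_le hB (by omega) hk Ω

end
end
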